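/- arXiv:math/0008041 — 5 statements merged into one kernel-verified Lean document; each statement's English description precedes it below -/
import Mathlib

section
/- Let M be finitely generated, let t ∈ ℕ and p ∈ {1,…,n}. Assume that H_{p−1}^l(n) = 0 for every l with 0 ≤ l ≤ t−1, and that H_p^t(n) ≠ 0. Then dim_K H_{p−1}^t(n) ≥ p. (In terms of graded Betti numbers: if β_{p−1,p−1+l}(M) = 0 for all l < t and β_{p,p+t}(M) ≠ 0, then β_{p−1,p−1+t}(M) ≥ p.) -/
open MvPolynomial

noncomputable section

/-- The Koszul differential on families of module elements indexed by finite subsets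
of `Fin n`. -/
def koszulD (n : ℕ) {K : Type*} [Field K] {M : Type*} [AddCommGroup M] [Module K M]
    [Module (MvPolynomial (Fin n) K) M] [IsScalarTower K (MvPolynomial (Fin n) K) M] :
    (Finset (Fin n) → M) →ₗ[K] (Finset (Fin n) → M) where
  toFun m L := ∑ k ∈ Lᶜ, ((-1 : ℤ) ^ (L.filter (fun l => l < k)).card) •
      ((X k : MvPolynomial (Fin n) K) • m (insert k L))
  map_add' a b := by
    funext L
    simp [smul_add, Finset.sum_add_distrib]
  map_smul' c a := by
    funext L
    simp only [Pi.smul_apply, RingHom.id_apply, Finset.smul_sum]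
    refine Finset.sum_congr rfl fun k _ => ?_
    rw [smul_comm (X k : MvPolynomial (Fin n) K) c, smul_comm ((-1 : ℤ) ^ (L.filter (fun l => l < k)).card) c]

/-- The degree-`(i, i+t)` piece of the Koszul complex of `x_1, …, x_j` with values in the
graded module with graded pieces `gr`: families `(m_J)` with `m_J ∈ gr t`, supported on
`i`-element subsets of `{1, …, j}` (i.e. of `{0, …, j-1}` in `Fin n`). -/
def koszulC (n : ℕ) {K : Type*} [Field K] {M : Type*} [AddCommGroup M] [Module K M]
    (gr : ℤ → Submodule K M) (i : ℕ) (t : ℤ) (j : ℕ) :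
    Submodule K (Finset (Fin n) → M) where
  carrier := {m | ∀ J : Finset (Fin n),
    m J ∈ gr t ∧ (¬(J.card = i ∧ ∀ k ∈ J, (k : ℕ) < j) → m J = 0)}
  zero_mem' := fun J => ⟨(gr t).zero_mem, fun _ => rfl⟩
  add_mem' := by
    intro a b ha hb J
    refine ⟨(gr t).add_mem (ha J).1 (hb J).1, fun h => ?_⟩
    simp [Pi.add_apply, (ha J).2 h, (hb J).2 h]
  smul_mem' := by
    intro c a ha J
    exact ⟨(gr t).smul_mem c (ha J).1, fun h => by simp [Pi.smul_apply, (ha J).2 h]⟩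

/-- Cycles: `Z_i^t(j)`. -/
def koszulZ (n : ℕ) {K : Type*} [Field K] {M : Type*} [AddCommGroup M] [Module K M]
    [Module (MvPolynomial (Fin n) K) M] [IsScalarTower K (MvPolynomial (Fin n) K) M]
    (gr : ℤ → Submodule K M) (i : ℕ) (t : ℤ) (j : ℕ) :
    Submodule K (Finset (Fin n) → M) :=
  koszulC n gr i t j ⊓ LinearMap.ker (koszulD n)

/-- Boundaries: `B_i^t(j)`, the image of `C_{i+1}^{t-1}(j)` under the differential. -/
def koszulB (n : ℕ) {K : Type*} [Field K] {M : Type*} [AddCommGroup M] [Module K M]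
    [Module (MvPolynomial (Fin n) K) M] [IsScalarTower K (MvPolynomial (Fin n) K) M]
    (gr : ℤ → Submodule K M) (i : ℕ) (t : ℤ) (j : ℕ) :
    Submodule K (Finset (Fin n) → M) :=
  (koszulC n gr (i + 1) (t - 1) j).map (koszulD n)

/-- The contraction `∂_k`. -/
def koszulContr (n : ℕ) {M : Type*} [AddCommGroup M] (k : Fin n)
    (m : Finset (Fin n) → M) : Finset (Fin n) → M :=
  fun L => if k ∈ L then 0
    else ((-1 : ℤ) ^ (L.filter (fun l => l < k)).card) • m (insert k L)

end

namespace Koszul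

noncomputable section

variable {K : Type*} [Field K] {n : ℕ} {M : Type*} [AddCommGroup M] [Module K M]

/-- The sign `(-1)^{#{l ∈ L : l < k}}`. -/
def sgn (k : Fin n) (L : Finset (Fin n)) : ℤ :=
  (-1 : ℤ) ^ (L.filter (fun l => l < k)).card

lemma sgn_mul_self (k : Fin n) (L : Finset (Fin n)) : sgn k L * sgn k L = 1 := by
  rw [sgn, ← pow_add, ← two_mul, pow_mul]
  simp

lemma sgn_insert (k k' : Fin n) (L : Finset (Fin n)) (hk : k ∉ L) :
    sgn k' (insert k L) = (if k < k' then -1 else 1) * sgn k' L := by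
  unfold sgn
  rw [Finset.filter_insert]
  split_ifs with h
  · rw [Finset.card_insert_of_notMem (by simp [hk]), pow_succ']
  · rw [one_mul]

lemma sgn_erase (k k' : Fin n) (L : Finset (Fin n)) (hk : k ∈ L) :
    sgn k' (L.erase k) = (if k < k' then -1 else 1) * sgn k' L := by
  have h := sgn_insert k k' (L.erase k) (Finset.notMem_erase k L)
  rw [Finset.insert_erase hk] at h
  rw [h]
  split_ifs <;> simp

lemma sgn_insert_self (k : Fin n) (L : Finset (Fin n)) : sgn k (insert k L) = sgn k L := by
  simp [sgn, Finset.filter_insert]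

lemma sgn_erase_self (k : Fin n) (L : Finset (Fin n)) : sgn k (L.erase k) = sgn k L := by
  by_cases hk : k ∈ L
  · simp [sgn_erase k k L hk]
  · rw [Finset.erase_eq_of_notMem hk]

/-- Contraction with the `k`-th coordinate functional, as a linear map. -/
def contr (K : Type*) [Field K] [Module K M] (k : Fin n) :
    (Finset (Fin n) → M) →ₗ[K] (Finset (Fin n) → M) where
  toFun := koszulContr n k
  map_add' a b := by
    funext L
    simp only [koszulContr, Pi.add_apply]
    split_ifs <;> simp
  map_smul' c a := by
    funext L
    simp only [koszulContr, Pi.smul_apply, RingHom.id_apply]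
    split_ifs
    · simp
    · rw [smul_comm]

lemma contr_apply (k : Fin n) (m : Finset (Fin n) → M) (L : Finset (Fin n)) :
    contr K k m L = if k ∈ L then 0 else sgn k L • m (insert k L) := rfl

/-- Exterior multiplication by the `k`-th basis vector. -/
def wedge (K : Type*) [Field K] [Module K M] (k : Fin n) :
    (Finset (Fin n) → M) →ₗ[K] (Finset (Fin n) → M) where
  toFun m L := if k ∈ L then sgn k L • m (L.erase k) else 0
  map_add' a b := by
    funext L
    simp only [Pi.add_apply]
    split_ifs <;> simp
  map_smul' c a := by
    funext L
    simp only [Pi.smul_apply, RingHom.id_apply]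
    split_ifs
    · rw [smul_comm]
    · simp

lemma wedge_apply (k : Fin n) (m : Finset (Fin n) → M) (L : Finset (Fin n)) :
    wedge K k m L = if k ∈ L then sgn k L • m (L.erase k) else 0 := rfl

lemma contr_contr_self (k : Fin n) (m : Finset (Fin n) → M) :
    contr K k (contr K k m) = 0 := by
  funext L
  simp [contr_apply]

lemma contr_contr (k k' : Fin n) (m : Finset (Fin n) → M) :
    contr K k (contr K k' m) + contr K k' (contr K k m) = 0 := by
  rcases eq_or_ne k k' with rfl | hne
  · simp [contr_contr_self]
  funext L
  simp only [contr_apply, Pi.add_apply, Pi.zero_apply, Finset.mem_insert, hne, hne.symm, false_or]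
  by_cases h : k ∈ L <;> by_cases h' : k' ∈ L <;> simp only [h, h', if_true, if_false, smul_zero,
    add_zero]
  rw [sgn_insert k k' L h, sgn_insert k' k L h', Finset.insert_comm k' k, smul_smul, smul_smul,
    ← add_smul]
  convert zero_smul ℤ _
  rcases lt_or_gt_of_ne hne with h | h <;> simp only [h, h.not_gt, if_true, if_false] <;> ring

lemma contr_wedge_self (k : Fin n) (m : Finset (Fin n) → M) :
    contr K k (wedge K k m) + wedge K k (contr K k m) = m := by
  funext L
  by_cases h : k ∈ L <;>
    simp [contr_apply, wedge_apply, h, sgn_insert_self, sgn_erase_self, smul_smul, sgn_mul_self]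

lemma contr_wedge_of_ne {k k' : Fin n} (hne : k ≠ k') (m : Finset (Fin n) → M) :
    contr K k (wedge K k' m) + wedge K k' (contr K k m) = 0 := by
  funext L
  simp only [contr_apply, wedge_apply, Pi.add_apply, Pi.zero_apply, Finset.mem_insert, hne.symm,
    false_or, Finset.mem_erase, ne_eq, hne, not_false_eq_true, true_and]
  by_cases h : k ∈ L <;> by_cases h' : k' ∈ L <;> simp only [h, h', if_true, if_false, smul_zero,
    add_zero]
  rw [sgn_insert k k' L h, sgn_erase k' k L h', Finset.erase_insert_of_ne hne, smul_smul, smul_smul,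
    ← add_smul]
  convert zero_smul ℤ _
  rcases lt_or_gt_of_ne hne with h | h <;> simp only [h, h.not_gt, if_true, if_false] <;> ring

/-- Contraction with the linear functional with coefficients `φ`. -/
def contrVec (φ : Fin n → K) : (Finset (Fin n) → M) →ₗ[K] (Finset (Fin n) → M) :=
  ∑ k, φ k • contr K k

/-- Exterior multiplication by the vector `v`. -/
def wedgeVec (v : Fin n → K) : (Finset (Fin n) → M) →ₗ[K] (Finset (Fin n) → M) :=
  ∑ k, v k • wedge K k

lemma contrVec_apply (φ : Fin n → K) (m : Finset (Fin n) → M) :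
    contrVec φ m = ∑ k, φ k • contr K k m := by
  simp [contrVec, LinearMap.sum_apply]

lemma contr_eq_contrVec (k : Fin n) (m : Finset (Fin n) → M) :
    contr K k m = contrVec (Pi.single k (1 : K)) m := by
  simp [contrVec_apply, Pi.single_apply]

lemma wedgeVec_apply (v : Fin n → K) (m : Finset (Fin n) → M) :
    wedgeVec v m = ∑ k, v k • wedge K k m := by
  simp [wedgeVec, LinearMap.sum_apply]

lemma contrVec_contrVec_self (φ : Fin n → K) (m : Finset (Fin n) → M) :
    contrVec φ (contrVec φ m) = 0 := by
  have h : contrVec φ (contrVec φ m)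
      = ∑ x : Fin n × Fin n, (φ x.1 * φ x.2) • contr K x.1 (contr K x.2 m) := by
    rw [Fintype.sum_prod_type_right]
    simp only [contrVec_apply, map_sum, map_smul, Finset.smul_sum, smul_smul, mul_comm]
  rw [h]
  refine Finset.sum_involution (fun x _ => x.swap) ?_ ?_ ?_ ?_
  · intro x _
    simp only [Prod.fst_swap, Prod.snd_swap]
    rw [mul_comm (φ x.2), ← smul_add, contr_contr, smul_zero]
  · rintro ⟨k, k'⟩ _ hx heq
    obtain rfl : k' = k := congrArg Prod.fst heq
    simp [contr_contr_self] at hx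
  · simp
  · simp

lemma contrVec_contrVec (φ ψ : Fin n → K) (m : Finset (Fin n) → M) :
    contrVec φ (contrVec ψ m) = - contrVec ψ (contrVec φ m) := by
  have h := contrVec_contrVec_self (φ + ψ) m
  have hadd : ∀ x : Finset (Fin n) → M, contrVec (φ + ψ) x = contrVec φ x + contrVec ψ x := by
    intro x
    simp [contrVec_apply, add_smul, Finset.sum_add_distrib]
  rw [hadd, hadd, map_add, map_add, contrVec_contrVec_self, contrVec_contrVec_self, zero_add,
    add_zero] at h
  exact eq_neg_of_add_eq_zero_left h

lemma contrVec_wedgeVec (φ v : Fin n → K) (m : Finset (Fin n) → M) :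
    contrVec φ (wedgeVec v m) = (φ ⬝ᵥ v) • m - wedgeVec v (contrVec φ m) := by
  rw [eq_sub_iff_add_eq]
  simp only [contrVec_apply, wedgeVec_apply, map_sum, map_smul, Finset.smul_sum, smul_smul]
  rw [Finset.sum_comm (γ := Fin n), dotProduct, Finset.sum_smul, ← Finset.sum_add_distrib]
  conv_lhs => enter [2, k]; rw [← Finset.sum_add_distrib]
  rw [Finset.sum_comm]
  refine Finset.sum_congr rfl fun k _ => ?_
  rw [Finset.sum_eq_single k]
  · rw [mul_comm (v k), ← smul_add, contr_wedge_self]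
  · intro l _ hl
    rw [mul_comm (v k), ← smul_add, contr_wedge_of_ne hl, smul_zero]
  · simp

lemma mem_koszulC {gr : ℤ → Submodule K M} {i : ℕ} {t : ℤ} {m : Finset (Fin n) → M} :
    m ∈ koszulC n gr i t n ↔ ∀ J, m J ∈ gr t ∧ (J.card ≠ i → m J = 0) := by
  change (∀ J : Finset (Fin n), m J ∈ gr t ∧ (¬(J.card = i ∧ ∀ k ∈ J, (k : ℕ) < n) → m J = 0)) ↔ _
  simp

lemma eq_zero_of_mem_koszulC {gr : ℤ → Submodule K M} {i : ℕ} {t : ℤ} (ht : gr t = ⊥)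
    {m : Finset (Fin n) → M} (hm : m ∈ koszulC n gr i t n) : m = 0 := by
  funext J
  have h := (mem_koszulC.1 hm J).1
  rwa [ht, Submodule.mem_bot] at h

lemma contrVec_mem {gr : ℤ → Submodule K M} {i : ℕ} {t : ℤ} (φ : Fin n → K)
    {m : Finset (Fin n) → M} (hm : m ∈ koszulC n gr (i + 1) t n) :
    contrVec φ m ∈ koszulC n gr i t n := by
  rw [contrVec_apply]
  refine Submodule.sum_mem _ fun k _ => Submodule.smul_mem _ _ (mem_koszulC.2 fun J => ?_)
  rw [contr_apply]
  split_ifs with hk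
  · simp
  · refine ⟨zsmul_mem (mem_koszulC.1 hm _).1 _, fun hJ => ?_⟩
    rw [(mem_koszulC.1 hm _).2, smul_zero]
    rw [Finset.card_insert_of_notMem hk]
    omega

lemma wedgeVec_mem {gr : ℤ → Submodule K M} {i : ℕ} {t : ℤ} (v : Fin n → K)
    {m : Finset (Fin n) → M} (hm : m ∈ koszulC n gr i t n) :
    wedgeVec v m ∈ koszulC n gr (i + 1) t n := by
  rw [wedgeVec_apply]
  refine Submodule.sum_mem _ fun k _ => Submodule.smul_mem _ _ (mem_koszulC.2 fun J => ?_)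
  rw [wedge_apply]
  split_ifs with hk
  · refine ⟨zsmul_mem (mem_koszulC.1 hm _).1 _, fun hJ => ?_⟩
    rw [(mem_koszulC.1 hm _).2, smul_zero]
    have := Finset.card_erase_add_one hk
    omega
  · simp

/-- A family in homological degree `i` killed by more than `n - i` independent contractions
vanishes. -/
lemma eq_zero_of_contrVec_eq_zero {gr : ℤ → Submodule K M} {t : ℤ} {r : ℕ} {φ v : ℕ → Fin n → K}
    (hdual : ∀ i < r, ∀ j < r, φ i ⬝ᵥ v j = if i = j then 1 else 0) :
    ∀ s ≤ r, ∀ {i : ℕ} {m : Finset (Fin n) → M}, n < i + s → m ∈ koszulC n gr i t n →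
      (∀ j < s, contrVec (φ j) m = 0) → m = 0 := by
  intro s
  induction s with
  | zero =>
    intro _ i m hi hm _
    funext J
    refine (mem_koszulC.1 hm J).2 ?_
    have := Finset.card_le_univ J
    rw [Fintype.card_fin] at this
    omega
  | succ s ih =>
    intro hs i m hi hm hms
    have hw : wedgeVec (v s) m = 0 := by
      refine ih (by omega) (i := i + 1) (by omega) (wedgeVec_mem _ hm) fun j hj => ?_
      rw [contrVec_wedgeVec, hms j (by omega), hdual j (by omega) s (by omega)]
      simp [hj.ne]
    have h := contrVec_wedgeVec (φ s) (v s) m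
    rw [hw, hms s (by omega), hdual s (by omega) s (by omega)] at h
    simpa using h.symm

/-- The map sending a functional to the contraction of `m` with it. -/
def contrMap (m : Finset (Fin n) → M) : (Fin n → K) →ₗ[K] (Finset (Fin n) → M) where
  toFun φ := contrVec φ m
  map_add' φ ψ := by simp [contrVec_apply, add_smul, Finset.sum_add_distrib]
  map_smul' c φ := by simp [contrVec_apply, Finset.smul_sum, smul_smul]

lemma exists_dual_families (W : Submodule K (Fin n → K)) :
    ∃ φ v : ℕ → Fin n → K, (∀ i < Module.finrank K W, φ i ∈ W) ∧
      ∀ i < Module.finrank K W, ∀ j < Module.finrank K W,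
        φ i ⬝ᵥ v j = if i = j then 1 else 0 := by
  obtain ⟨g, hg⟩ := W.subtype.exists_leftInverse_of_injective W.ker_subtype
  let b := Module.finBasis K W
  refine ⟨fun i => if h : i < Module.finrank K W then b ⟨i, h⟩ else 0,
    fun j k => if h : j < Module.finrank K W then b.repr (g (Pi.single k 1)) ⟨j, h⟩ else 0,
    fun i hi => by simp [hi], fun i hi j hj => ?_⟩
  have hgi : g (b ⟨i, hi⟩ : Fin n → K) = b ⟨i, hi⟩ := LinearMap.congr_fun hg _
  have hsum := congrArg (fun x => b.repr (g x) ⟨j, hj⟩) (pi_eq_sum_univ' (b ⟨i, hi⟩ : Fin n → K))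
  simp only [hgi, map_sum, map_smul, Finsupp.coe_finsetSum, Finset.sum_apply, Finsupp.smul_apply,
    Module.Basis.repr_self, Finsupp.single_apply, Fin.mk.injEq, smul_eq_mul] at hsum
  simp only [hi, hj, dif_pos, dotProduct]
  rw [hsum]

variable [Module (MvPolynomial (Fin n) K) M] [IsScalarTower K (MvPolynomial (Fin n) K) M]

/-- Multiplication of families by the variable `x_k`. -/
def mulX (k : Fin n) : (Finset (Fin n) → M) →ₗ[K] (Finset (Fin n) → M) where
  toFun m L := (X k : MvPolynomial (Fin n) K) • m L
  map_add' a b := by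
    funext L
    simp
  map_smul' c a := by
    funext L
    simp only [Pi.smul_apply, RingHom.id_apply]
    rw [smul_comm]

lemma mulX_apply (k : Fin n) (m : Finset (Fin n) → M) (L : Finset (Fin n)) :
    mulX (K := K) k m L = (X k : MvPolynomial (Fin n) K) • m L := rfl

/-- Multiplication of families by the linear form with coefficients `v`. -/
def mulVec (v : Fin n → K) : (Finset (Fin n) → M) →ₗ[K] (Finset (Fin n) → M) :=
  ∑ k, v k • mulX (K := K) k

lemma mulVec_apply (v : Fin n → K) (m : Finset (Fin n) → M) :
    mulVec v m = ∑ k, v k • mulX (K := K) k m := by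
  simp [mulVec, LinearMap.sum_apply]

lemma contr_mulX (k k' : Fin n) (m : Finset (Fin n) → M) :
    contr K k (mulX (K := K) k' m) = mulX (K := K) k' (contr K k m) := by
  funext L
  simp only [contr_apply, mulX_apply]
  split_ifs
  · simp
  · rw [smul_comm]

lemma wedge_mulX (k k' : Fin n) (m : Finset (Fin n) → M) :
    wedge K k (mulX (K := K) k' m) = mulX (K := K) k' (wedge K k m) := by
  funext L
  simp only [wedge_apply, mulX_apply]
  split_ifs
  · rw [smul_comm]
  · simp

lemma mulX_mulX (k k' : Fin n) (m : Finset (Fin n) → M) :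
    mulX (K := K) k (mulX (K := K) k' m) = mulX (K := K) k' (mulX (K := K) k m) := by
  funext L
  simp only [mulX_apply]
  rw [smul_comm]

lemma koszulD_eq (m : Finset (Fin n) → M) :
    koszulD n (K := K) m = ∑ k, mulX (K := K) k (contr K k m) := by
  funext L
  rw [Finset.sum_apply]
  change ∑ k ∈ Lᶜ, _ = _
  refine Finset.sum_subset_zero_on_sdiff (Finset.subset_univ _) ?_ ?_
  · intro k hk
    simp only [Finset.mem_sdiff, Finset.mem_univ, Finset.mem_compl, true_and, not_not] at hk
    simp [mulX_apply, contr_apply, hk]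
  · intro k hk
    rw [Finset.mem_compl] at hk
    simp only [mulX_apply, contr_apply, hk, if_false]
    rw [smul_comm]
    rfl

lemma contrVec_mulX (φ : Fin n → K) (k : Fin n) (m : Finset (Fin n) → M) :
    contrVec φ (mulX (K := K) k m) = mulX (K := K) k (contrVec φ m) := by
  simp only [contrVec_apply, map_sum, map_smul, contr_mulX]

lemma contrVec_mulVec (φ v : Fin n → K) (m : Finset (Fin n) → M) :
    contrVec φ (mulVec v m) = mulVec v (contrVec φ m) := by
  simp only [mulVec_apply, map_sum, map_smul, contrVec_mulX]

lemma koszulD_contrVec (φ : Fin n → K) (m : Finset (Fin n) → M) :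
    koszulD n (K := K) (contrVec φ m) = - contrVec φ (koszulD n (K := K) m) := by
  simp only [koszulD_eq, map_sum, contrVec_mulX, ← Finset.sum_neg_distrib]
  refine Finset.sum_congr rfl fun k _ => ?_
  rw [contr_eq_contrVec, contr_eq_contrVec, contrVec_contrVec, map_neg]

lemma koszulD_mulVec (v : Fin n → K) (m : Finset (Fin n) → M) :
    koszulD n (K := K) (mulVec v m) = mulVec v (koszulD n (K := K) m) := by
  have h : ∀ k, koszulD n (K := K) (mulX (K := K) k m) = mulX (K := K) k (koszulD n (K := K) m) := by
    intro k
    simp only [koszulD_eq, map_sum, contr_mulX]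
    exact Finset.sum_congr rfl fun k' _ => mulX_mulX _ _ _
  simp only [mulVec_apply, map_sum, map_smul, h]

lemma koszulD_wedgeVec (v : Fin n → K) (m : Finset (Fin n) → M) :
    koszulD n (K := K) (wedgeVec v m) = mulVec v m - wedgeVec v (koszulD n (K := K) m) := by
  have h : ∀ k, wedgeVec v (mulX (K := K) k (contr K k m))
      = mulX (K := K) k (wedgeVec v (contr K k m)) := by
    intro k
    simp only [wedgeVec_apply, map_sum, map_smul, wedge_mulX]
  simp only [koszulD_eq, map_sum, h, mulVec_apply, ← Finset.sum_sub_distrib]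
  refine Finset.sum_congr rfl fun k _ => ?_
  rw [contr_eq_contrVec, contr_eq_contrVec, contrVec_wedgeVec, map_sub, map_smul]
  simp

section Graded

variable {gr : ℤ → Submodule K M}
  (hcompat : ∀ (i : Fin n) (l : ℤ), ∀ m ∈ gr l, (X i : MvPolynomial (Fin n) K) • m ∈ gr (l + 1))

include hcompat

lemma mulX_mem {i : ℕ} {t : ℤ} (k : Fin n) {m : Finset (Fin n) → M}
    (hm : m ∈ koszulC n gr i t n) : mulX (K := K) k m ∈ koszulC n gr i (t + 1) n := by
  refine mem_koszulC.2 fun J => ⟨hcompat _ _ _ (mem_koszulC.1 hm J).1, fun hJ => ?_⟩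
  rw [mulX_apply, (mem_koszulC.1 hm J).2 hJ, smul_zero]

lemma mulVec_mem {i : ℕ} {t : ℤ} (v : Fin n → K) {m : Finset (Fin n) → M}
    (hm : m ∈ koszulC n gr i t n) : mulVec v m ∈ koszulC n gr i (t + 1) n := by
  rw [mulVec_apply]
  exact Submodule.sum_mem _ fun k _ => Submodule.smul_mem _ _ (mulX_mem hcompat k hm)

lemma koszulD_mem {i : ℕ} {t : ℤ} {m : Finset (Fin n) → M}
    (hm : m ∈ koszulC n gr (i + 1) t n) : koszulD n (K := K) m ∈ koszulC n gr i (t + 1) n := by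
  rw [koszulD_eq]
  refine Submodule.sum_mem _ fun k _ => mulX_mem hcompat k ?_
  rw [contr_eq_contrVec]
  exact contrVec_mem _ hm

/-- If the Koszul homology `H_q` vanishes in internal degrees below `t`, then in degrees up to `t`
a boundary killed by the contractions with `φ 0, …, φ (s - 1)` bounds a chain killed by them. -/
lemma exists_preimage_contrVec_eq_zero (hneg : ∀ l : ℤ, l < 0 → gr l = ⊥) {t q : ℕ}
    (hvanish : ∀ l : ℕ, l < t → koszulZ n gr q (l : ℤ) n ≤ koszulB n gr q (l : ℤ) n)
    {r : ℕ} {φ v : ℕ → Fin n → K}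
    (hdual : ∀ i < r, ∀ j < r, φ i ⬝ᵥ v j = if i = j then 1 else 0) :
    ∀ s ≤ r, ∀ l ≤ t, ∀ z ∈ koszulB n gr q (l : ℤ) n, (∀ i < s, contrVec (φ i) z = 0) →
      ∃ w ∈ koszulC n gr (q + 1) ((l : ℤ) - 1) n,
        (∀ i < s, contrVec (φ i) w = 0) ∧ koszulD n (K := K) w = z := by
  intro s
  induction s with
  | zero =>
    rintro - l - z ⟨w, hw, rfl⟩ -
    exact ⟨w, hw, by simp, rfl⟩
  | succ s ihs =>
    intro hs l
    induction l with
    | zero =>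
      rintro - z ⟨w, hw, rfl⟩ -
      refine ⟨0, Submodule.zero_mem _, by simp, ?_⟩
      rw [eq_zero_of_mem_koszulC (hneg _ (by simp)) hw]
    | succ l ihl =>
      intro hl z hz hzs
      obtain ⟨w, hw, hws, rfl⟩ := ihs (by omega) _ hl z hz fun i hi => hzs i (by omega)
      have hb : contrVec (φ s) w ∈ koszulC n gr q (l : ℤ) n := by
        have := contrVec_mem (φ s) hw
        rwa [Nat.cast_succ, add_sub_cancel_right] at this
      have hbs : ∀ i < s + 1, contrVec (φ i) (contrVec (φ s) w) = 0 := by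
        intro i hi
        rcases Nat.lt_succ_iff_lt_or_eq.1 hi with hi | rfl
        · rw [contrVec_contrVec, hws i hi, map_zero, neg_zero]
        · exact contrVec_contrVec_self _ _
      have hdb : koszulD n (K := K) (contrVec (φ s) w) = 0 := by
        rw [koszulD_contrVec, hzs s (by omega), neg_zero]
      obtain ⟨c, hc, hcs, hdc⟩ := ihl (by omega) _ (hvanish l (by omega) ⟨hb, hdb⟩) hbs
      refine ⟨w - wedgeVec (v s) (contrVec (φ s) w) + mulVec (v s) c,
        Submodule.add_mem _ (Submodule.sub_mem _ hw ?_) ?_, fun i hi => ?_, ?_⟩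
      · rw [Nat.cast_succ, add_sub_cancel_right]
        exact wedgeVec_mem _ hb
      · rw [Nat.cast_succ, add_sub_right_comm]
        exact mulVec_mem hcompat _ hc
      · rw [map_add, map_sub, contrVec_mulVec, hcs i hi, contrVec_wedgeVec, hbs i hi,
          hdual i (by omega) s (by omega), map_zero, map_zero, sub_zero, add_zero]
        rcases Nat.lt_succ_iff_lt_or_eq.1 hi with hi | rfl
        · simp [hi.ne, hws i hi]
        · simp
      · rw [map_add, map_sub, koszulD_wedgeVec, hdb, koszulD_mulVec, hdc, map_zero, sub_zero,
          sub_add_cancel]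

/-- A family whose contractions with `φ 0, …, φ (r - 1)` are boundaries is homologous to one
killed by these contractions. -/
lemma exists_sub_mem_koszulB_contrVec_eq_zero (hneg : ∀ l : ℤ, l < 0 → gr l = ⊥) {t q : ℕ}
    (hvanish : ∀ l : ℕ, l < t → koszulZ n gr q (l : ℤ) n ≤ koszulB n gr q (l : ℤ) n)
    {r : ℕ} {φ v : ℕ → Fin n → K}
    (hdual : ∀ i < r, ∀ j < r, φ i ⬝ᵥ v j = if i = j then 1 else 0)
    {z : Finset (Fin n) → M}
    (hφ : ∀ i < r, contrVec (φ i) z ∈ koszulB n gr q (t : ℤ) n) :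
    ∀ s ≤ r, ∃ b ∈ koszulC n gr (q + 1 + 1) ((t : ℤ) - 1) n,
      ∀ i < s, contrVec (φ i) (z + koszulD n (K := K) b) = 0 := by
  intro s
  induction s with
  | zero => exact fun _ => ⟨0, Submodule.zero_mem _, by simp⟩
  | succ s ih =>
    intro hs
    obtain ⟨b, hb, hbs⟩ := ih (by omega)
    have hy : contrVec (φ s) (z + koszulD n (K := K) b) ∈ koszulB n gr q (t : ℤ) n := by
      rw [map_add]
      refine Submodule.add_mem _ (hφ s (by omega)) ⟨-contrVec (φ s) b,
        Submodule.neg_mem _ (contrVec_mem _ hb), ?_⟩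
      rw [map_neg, koszulD_contrVec, neg_neg]
    have hys : ∀ i < s, contrVec (φ i) (contrVec (φ s) (z + koszulD n (K := K) b)) = 0 := by
      intro i hi
      rw [contrVec_contrVec, hbs i hi, map_zero, neg_zero]
    obtain ⟨c, hc, hcs, hdc⟩ := exists_preimage_contrVec_eq_zero hcompat hneg hvanish hdual
      (s + 1) hs t le_rfl _ hy (fun i hi => by
        rcases Nat.lt_succ_iff_lt_or_eq.1 hi with hi | rfl
        · exact hys i hi
        · exact contrVec_contrVec_self _ _)
    refine ⟨b + wedgeVec (v s) c, Submodule.add_mem _ hb (wedgeVec_mem _ hc), fun i hi => ?_⟩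
    have hd : contrVec (φ i) (koszulD n (K := K) (wedgeVec (v s) c))
        = -((φ i ⬝ᵥ v s) • koszulD n (K := K) c) := by
      rw [← neg_eq_iff_eq_neg, ← koszulD_contrVec, contrVec_wedgeVec, hcs i hi, map_zero, sub_zero,
        map_smul]
    rw [map_add (koszulD n), ← add_assoc, map_add, hd, hdc, hdual i (by omega) s (by omega)]
    rcases Nat.lt_succ_iff_lt_or_eq.1 hi with hi | rfl
    · simp [hi.ne, hbs i hi]
    · simp

end Graded

end

end Koszul

open MvPolynomial in
/-- Theorem 2.5: if `β_{p-1,p-1+l}(M) = 0` for all `l < t` and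
`β_{p,p+t}(M) ≠ 0`, then `β_{p-1,p-1+t}(M) ≥ p`, expressed via Koszul homology
`H_i^t(n) = Z_i^t(n)/B_i^t(n)`. -/
theorem betti_lower_bound_p {K : Type*} [Field K] {n : ℕ} (hn : 1 ≤ n)
    {M : Type*} [AddCommGroup M] [Module K M]
    [Module (MvPolynomial (Fin n) K) M] [IsScalarTower K (MvPolynomial (Fin n) K) M]
    [Module.Finite (MvPolynomial (Fin n) K) M]
    (gr : ℤ → Submodule K M)
    (hdecomp : DirectSum.IsInternal gr)
    (hcompat : ∀ (i : Fin n) (l : ℤ), ∀ m ∈ gr l,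
      (X i : MvPolynomial (Fin n) K) • m ∈ gr (l + 1))
    (hneg : ∀ l : ℤ, l < 0 → gr l = ⊥)
    (t : ℕ) (p : ℕ) (hp1 : 1 ≤ p) (hpn : p ≤ n)
    (hvanish : ∀ l : ℕ, l < t →
      koszulZ n gr (p - 1) (l : ℤ) n ≤ koszulB n gr (p - 1) (l : ℤ) n)
    (hnonzero : ¬ koszulZ n gr p (t : ℤ) n ≤ koszulB n gr p (t : ℤ) n) :
    (p : Cardinal) ≤ Module.rank K
      (koszulZ n gr (p - 1) (t : ℤ) n ⧸
        (koszulB n gr (p - 1) (t : ℤ) n).comap (koszulZ n gr (p - 1) (t : ℤ) n).subtype) := by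
  obtain ⟨q, rfl⟩ : ∃ q, p = q + 1 := ⟨p - 1, by omega⟩
  rw [Nat.add_sub_cancel] at hvanish ⊢
  obtain ⟨z, hz, hzB⟩ := SetLike.not_le_iff_exists.1 hnonzero
  by_contra! hrank
  have hcycle : ∀ φ : Fin n → K, Koszul.contrMap z φ ∈ koszulZ n gr q (t : ℤ) n := fun φ => by
    refine ⟨Koszul.contrVec_mem φ hz.1, ?_⟩
    change koszulD n (Koszul.contrVec φ z) = 0
    rw [Koszul.koszulD_contrVec, LinearMap.mem_ker.1 hz.2, map_zero, neg_zero]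
  let F := ((koszulB n gr q (t : ℤ) n).comap (koszulZ n gr q (t : ℤ) n).subtype).mkQ ∘ₗ
    (Koszul.contrMap z).codRestrict (koszulZ n gr q (t : ℤ) n) hcycle
  have hF : Module.finrank K (LinearMap.range F) < q + 1 := by
    have h := (Submodule.rank_le (LinearMap.range F)).trans_lt hrank
    rw [← Module.finrank_eq_rank] at h
    exact_mod_cast h
  have hker := F.finrank_range_add_finrank_ker
  rw [Module.finrank_fin_fun] at hker
  obtain ⟨φ, v, hφ, hdual⟩ := Koszul.exists_dual_families (LinearMap.ker F)
  have hφB : ∀ i < Module.finrank K (LinearMap.ker F),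
      Koszul.contrVec (φ i) z ∈ koszulB n gr q (t : ℤ) n := fun i hi => by
    have h := LinearMap.mem_ker.1 (hφ i hi)
    rwa [LinearMap.comp_apply, Submodule.mkQ_apply, Submodule.Quotient.mk_eq_zero] at h
  obtain ⟨b, hb, hbz⟩ := Koszul.exists_sub_mem_koszulB_contrVec_eq_zero hcompat hneg hvanish hdual
    hφB _ le_rfl
  have hdb := Koszul.koszulD_mem hcompat hb
  rw [sub_add_cancel] at hdb
  have hzero := Koszul.eq_zero_of_contrVec_eq_zero hdual _ le_rfl (by omega)
    (Submodule.add_mem _ hz.1 hdb) hbz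
  refine hzB ⟨-b, Submodule.neg_mem _ hb, ?_⟩
  rw [map_neg, eq_neg_of_add_eq_zero_left hzero]
end

section
/- Let M be finitely generated with M_l = 0 for all l < d. Let p ∈ {0,…,n} and assume H_p^d(n) ≠ 0. Then dim_K H_i^d(n) ≥ binom(p,i) for every i = 0,…,p. (In terms of graded Betti numbers: if M has initial degree ≥ d and β_{p,p+d}(M) ≠ 0, then the Betti numbers of the linear strand satisfy β_{i,i+d}(M) ≥ binom(p,i) for i = 0,…,p.) -/
open MvPolynomial

theorem neg_one_pow_card_filter_insert {n : ℕ} {L : Finset (Fin n)} {j k : Fin n}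
    (hj : j ∉ L) (hk : k ∉ L) (hjk : j ≠ k) :
    (-1 : ℤ) ^ (L.filter (fun l => l < j)).card *
        (-1 : ℤ) ^ ((insert j L).filter (fun l => l < k)).card =
      -((-1 : ℤ) ^ (L.filter (fun l => l < k)).card *
        (-1 : ℤ) ^ ((insert k L).filter (fun l => l < j)).card) := by
  rw [Finset.filter_insert, Finset.filter_insert]
  rcases lt_or_gt_of_ne hjk with h | h
  · rw [if_pos h, if_neg h.le.not_gt, Finset.card_insert_of_notMem (by simp [hj])]
    ring
  · rw [if_neg h.le.not_gt, if_pos h, Finset.card_insert_of_notMem (by simp [hk])]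
    ring

theorem koszulContr_mem_koszulC {K : Type*} [Field K] {n : ℕ} {M : Type*}
    [AddCommGroup M] [Module K M] {gr : ℤ → Submodule K M} {i j : ℕ} {t : ℤ}
    {m : Finset (Fin n) → M} (k : Fin n) (hm : m ∈ koszulC n gr (i + 1) t j) :
    koszulContr n k m ∈ koszulC n gr i t j := by
  intro L
  by_cases hk : k ∈ L
  · simp [koszulContr, hk]
  · simp only [koszulContr, if_neg hk]
    refine ⟨(gr t).smul_of_tower_mem _ (hm _).1, fun h => ?_⟩
    rw [(hm _).2, smul_zero]
    rintro ⟨hcard, hlt⟩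
    rw [Finset.card_insert_of_notMem hk] at hcard
    exact h ⟨by omega, fun l hl => hlt l (Finset.mem_insert_of_mem hl)⟩

section Contraction

variable {K : Type*} [Field K] {n : ℕ} {M : Type*} [AddCommGroup M] [Module K M]
  [Module (MvPolynomial (Fin n) K) M] [IsScalarTower K (MvPolynomial (Fin n) K) M]

/-- The Koszul differential anticommutes with contractions. -/
theorem koszulD_koszulContr (k : Fin n) (m : Finset (Fin n) → M) :
    koszulD n (K := K) (koszulContr n k m) = -koszulContr n k (koszulD n (K := K) m) := by
  funext L
  change ∑ j ∈ Lᶜ, _ = -(if k ∈ L then 0 else _ • ∑ j ∈ (insert k L)ᶜ, _)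
  by_cases hk : k ∈ L
  · simp [koszulContr, hk]
  · rw [if_neg hk, Finset.compl_insert, Finset.smul_sum, ← Finset.sum_neg_distrib,
      ← Finset.add_sum_erase Lᶜ _ (Finset.mem_compl.2 hk)]
    simp only [koszulContr, Finset.mem_insert_self, if_true, smul_zero, zero_add]
    refine Finset.sum_congr rfl fun j hj => ?_
    obtain ⟨hjk, hj⟩ := Finset.mem_erase.1 hj
    rw [Finset.mem_compl] at hj
    rw [if_neg (by simp [hk, Ne.symm hjk]), Finset.insert_comm k j L,
      smul_comm (X j : MvPolynomial (Fin n) K), smul_smul, smul_smul,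
      neg_one_pow_card_filter_insert hj hk hjk, neg_smul]

theorem koszulContr_mem_koszulZ {gr : ℤ → Submodule K M} {i j : ℕ} {t : ℤ}
    {m : Finset (Fin n) → M} (k : Fin n) (hm : m ∈ koszulZ n gr (i + 1) t j) :
    koszulContr n k m ∈ koszulZ n gr i t j := by
  refine ⟨koszulContr_mem_koszulC k hm.1, ?_⟩
  rw [SetLike.mem_coe, LinearMap.mem_ker, koszulD_koszulContr, LinearMap.mem_ker.1 hm.2]
  funext L
  simp [koszulContr]

/-- Contracting a cycle successively along the elements of `S`, up to signs. -/
theorem exists_mem_koszulZ_contraction {gr : ℤ → Submodule K M} {j : ℕ} {t : ℤ}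
    {z : Finset (Fin n) → M} (S : Finset (Fin n)) (i : ℕ)
    (hz : z ∈ koszulZ n gr (i + S.card) t j) :
    ∃ m ∈ koszulZ n gr i t j, ∀ L,
      (Disjoint L S → m L = z (L ∪ S) ∨ m L = -z (L ∪ S)) ∧ (¬ Disjoint L S → m L = 0) := by
  induction S using Finset.induction_on generalizing i with
  | empty => exact ⟨z, hz, by simp⟩
  | insert k S hk ih =>
    rw [Finset.card_insert_of_notMem hk, add_comm S.card, ← add_assoc] at hz
    obtain ⟨m, hm, hmL⟩ := ih (i + 1) hz
    refine ⟨koszulContr n k m, koszulContr_mem_koszulZ k hm, fun L => ?_⟩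
    by_cases hkL : k ∈ L
    · simp [koszulContr, hkL]
    · have h := hmL (insert k L)
      simp only [koszulContr, if_false, Finset.disjoint_insert_left,
        Finset.disjoint_insert_right, hk, hkL, not_false_eq_true, true_and,
        Finset.insert_union, Finset.union_insert] at h ⊢
      refine ⟨fun hd => ?_, fun hd => by simp [h.2 hd]⟩
      rcases neg_one_pow_eq_or ℤ (L.filter (fun l => l < k)).card with hs | hs <;>
        rcases h.1 hd with hh | hh <;> simp [hs, hh]

end Contraction

/-- A family of vector-valued functions that is triangular with respect to an injective
weight is linearly independent. -/
theorem linearIndependent_of_triangular {K ι κ M : Type*} [Field K] [AddCommGroup M] [Module K M]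
    {f : ι → κ → M} {e : ι → κ} {w : ι → ℕ} (hw : Function.Injective w)
    (hdiag : ∀ a, f a (e a) ≠ 0) (hlt : ∀ a b, w b < w a → f b (e a) = 0) :
    LinearIndependent K f := by
  rw [linearIndependent_iff']
  intro s c hc
  by_contra! hne
  obtain ⟨a₀, ha₀, hca₀⟩ := hne
  classical
  obtain ⟨a, ha, hmax⟩ := (s.filter (fun a => c a ≠ 0)).exists_max_image w
    ⟨a₀, by simp [ha₀, hca₀]⟩
  rw [Finset.mem_filter] at ha
  have hsum := congrFun hc (e a)
  rw [Finset.sum_apply, Finset.sum_eq_single_of_mem a ha.1] at hsum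
  · exact (smul_ne_zero ha.2 (hdiag a)) hsum
  · intro b hb hba
    by_cases hcb : c b = 0
    · simp [hcb]
    · rw [Pi.smul_apply, hlt a b, smul_zero]
      exact lt_of_le_of_ne (hmax b (by simp [hb, hcb])) (hw.ne hba)

open MvPolynomial in
/-- Theorem 2.7: if `M` has initial degree `≥ d` and
`β_{p,p+d}(M) ≠ 0`, then the linear strand satisfies `β_{i,i+d}(M) ≥ C(p,i)` for
`i = 0, …, p`, expressed via Koszul homology `H_i^d(n) = Z_i^d(n)/B_i^d(n)`. -/
theorem betti_linear_strand_lower_bound {K : Type*} [Field K] {n : ℕ} (hn : 1 ≤ n)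
    {M : Type*} [AddCommGroup M] [Module K M]
    [Module (MvPolynomial (Fin n) K) M] [IsScalarTower K (MvPolynomial (Fin n) K) M]
    [Module.Finite (MvPolynomial (Fin n) K) M]
    (d : ℕ) (gr : ℤ → Submodule K M)
    (hdecomp : DirectSum.IsInternal gr)
    (hcompat : ∀ (i : Fin n) (l : ℤ), ∀ m ∈ gr l,
      (X i : MvPolynomial (Fin n) K) • m ∈ gr (l + 1))
    (hneg : ∀ l : ℤ, l < (d : ℤ) → gr l = ⊥)
    (p : ℕ) (hpn : p ≤ n)
    (hnonzero : ¬ koszulZ n gr p (d : ℤ) n ≤ koszulB n gr p (d : ℤ) n) :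
    ∀ i : ℕ, i ≤ p → (Nat.choose p i : Cardinal) ≤ Module.rank K
      (koszulZ n gr i (d : ℤ) n ⧸
        (koszulB n gr i (d : ℤ) n).comap (koszulZ n gr i (d : ℤ) n).subtype) := by
  intro i hip
  classical
  have hB : ∀ q, koszulB n gr q (d : ℤ) n = ⊥ := by
    intro q
    have hC : koszulC n gr (q + 1) ((d : ℤ) - 1) n = ⊥ := by
      refine (Submodule.eq_bot_iff _).2 fun m hm => funext fun J => ?_
      have h := (hm J).1
      rwa [hneg _ (by omega), Submodule.mem_bot] at h
    rw [koszulB, hC, Submodule.map_bot]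
  obtain ⟨z, hz, hz0⟩ := SetLike.not_le_iff_exists.1 hnonzero
  rw [hB, Submodule.mem_bot] at hz0
  let w : Finset (Fin n) → ℕ := fun A => ∑ a ∈ A, 2 ^ (a : ℕ)
  have hw : Function.Injective w := fun A B h => by
    refine Finset.map_injective Fin.valEmbedding (Finset.geomSum_injective le_rfl ?_)
    simpa [w] using h
  obtain ⟨J₀, hJ₀⟩ := Function.ne_iff.1 hz0
  obtain ⟨J, hJ, hmax⟩ := (Finset.univ.filter (fun A => z A ≠ 0)).exists_max_image w
    ⟨J₀, by simpa using hJ₀⟩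
  replace hJ : z J ≠ 0 := by simpa using hJ
  replace hmax : ∀ A, w J < w A → z A = 0 := fun A hA => by
    by_contra h
    exact (hmax A (by simpa using h)).not_gt hA
  have hcard : J.card = p := by
    by_contra h
    exact hJ ((hz.1 J).2 fun h' => h h'.1)
  have key : ∀ I : Finset.powersetCard i J, ∃ m ∈ koszulZ n gr i (d : ℤ) n, ∀ L,
      (Disjoint L (J \ I) → m L = z (L ∪ J \ I) ∨ m L = -z (L ∪ J \ I)) ∧
        (¬ Disjoint L (J \ I) → m L = 0) := by
    rintro ⟨I, hI⟩
    obtain ⟨hIJ, hIc⟩ := Finset.mem_powersetCard.1 hI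
    refine exists_mem_koszulZ_contraction (J \ I) i ?_
    rwa [Finset.card_sdiff_of_subset hIJ, hcard, hIc, Nat.add_sub_cancel' hip]
  choose f hfZ hf using key
  have hli : LinearIndependent K f := by
    refine linearIndependent_of_triangular (e := Subtype.val) (w := fun I => w I)
      (hw.comp Subtype.val_injective) ?_ ?_
    · intro I
      have hIJ := (Finset.mem_powersetCard.1 I.2).1
      have h := (hf I I).1 Finset.disjoint_sdiff
      rw [Finset.union_sdiff_of_subset hIJ] at h
      rcases h with h | h <;> simpa [h] using hJ
    · intro A B hBA
      have hBJ := (Finset.mem_powersetCard.1 B.2).1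
      by_cases hd : Disjoint (A : Finset (Fin n)) (J \ B)
      · have hzero : z (A ∪ J \ B) = 0 := by
          refine hmax _ ?_
          have h1 : w (A ∪ J \ B) = w A + w (J \ B) := Finset.sum_union hd
          have h2 : w (J \ B) + w B = w J := Finset.sum_sdiff hBJ
          have h3 : w B < w A := hBA
          omega
        rcases (hf B A).1 hd with h | h <;> simp [h, hzero]
      · exact (hf B A).2 hd
  have hli' : LinearIndependent K
      (fun I => (⟨f I, hfZ I⟩ : koszulZ n gr i (d : ℤ) n)) :=
    LinearIndependent.of_comp (koszulZ n gr i (d : ℤ) n).subtype hli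
  have hbot : (koszulB n gr i (d : ℤ) n).comap (koszulZ n gr i (d : ℤ) n).subtype = ⊥ := by
    rw [hB, Submodule.comap_bot, Submodule.ker_subtype]
  rw [(Submodule.quotEquivOfEqBot _ hbot).rank_eq]
  have h := hli'.cardinal_lift_le_rank
  rw [Cardinal.mk_coe_finset, Finset.card_powersetCard, hcard] at h
  simpa using h
end

section
/- Let k ∈ {1,…,n}, t ∈ ℕ and p with k ≤ p ≤ n. Assume H_k^l(n) = 0 for every l with 0 ≤ l ≤ t−1, and H_p^t(n) ≠ 0. Then dim_K H_i^t(n) ≥ binom(p,i) for every i with k ≤ i ≤ p. (In terms of graded Betti numbers this is Herzog's conjectured bound β_i^{k,lin}(M) ≥ binom(p,i), i = k,…,p, for ℤ^n-graded modules.) -/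
open MvPolynomial

/-- The `ℤ`-graded pieces of an `ℕⁿ`-graded module: `M_l = ⊕_{|a| = l} M_a`. -/
noncomputable def totalGrading {K : Type*} [Field K] {M : Type*} [AddCommGroup M]
    [Module K M] {n : ℕ} (gr : (Fin n → ℕ) → Submodule K M) : ℤ → Submodule K M :=
  fun l => ⨆ (a : Fin n → ℕ) (_ : (∑ i, (a i : ℤ)) = l), gr a

namespace KoszulStrand

open Finset

/-- The sign picked up when the exterior generator `k` is moved into its place in `L`. -/
def sign {n : ℕ} (k : Fin n) (L : Finset (Fin n)) : ℤ :=
  (-1 : ℤ) ^ (L.filter (fun l => l < k)).card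

theorem sign_mul_self {n : ℕ} (k : Fin n) (L : Finset (Fin n)) : sign k L * sign k L = 1 := by
  rw [sign, ← mul_pow]
  norm_num

theorem sign_insert {n : ℕ} {j : Fin n} {L : Finset (Fin n)} (k : Fin n) (hj : j ∉ L) :
    sign k (insert j L) = if j < k then -sign k L else sign k L := by
  unfold sign
  rw [filter_insert]
  split_ifs with h
  · rw [card_insert_of_notMem (by simp [hj]), pow_succ]
    ring
  · rfl

theorem sign_mul_sign_insert {n : ℕ} {j k : Fin n} {L : Finset (Fin n)} (hjk : j ≠ k)
    (hj : j ∉ L) (hk : k ∉ L) :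
    sign k (insert j L) * sign j (insert k L) = -(sign k L * sign j L) := by
  rw [sign_insert k hj, sign_insert j hk]
  rcases lt_or_gt_of_ne hjk with h | h
  · simp [h, h.le]
  · simp [h, h.le]

theorem sign_mul_sign_insert' {n : ℕ} {j k : Fin n} {L : Finset (Fin n)} (hjk : j ≠ k)
    (hj : j ∉ L) (hk : k ∉ L) :
    sign k L * sign j (insert k L) = -(sign j L * sign k (insert j L)) := by
  rw [sign_insert k hj, sign_insert j hk]
  rcases lt_or_gt_of_ne hjk with h | h
  · simp [h, h.le, mul_comm]
  · simp [h, h.le, mul_comm]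

section Operators

variable {n : ℕ} {K : Type*} [Field K] {M : Type*} [AddCommGroup M]

/-- Exterior multiplication by the generator `j`. -/
def wedge (j : Fin n) (m : Finset (Fin n) → M) : Finset (Fin n) → M :=
  fun L => if j ∈ L then sign j (L.erase j) • m (L.erase j) else 0

theorem contr_of_mem {k : Fin n} {L : Finset (Fin n)} (m : Finset (Fin n) → M) (h : k ∈ L) :
    koszulContr n k m L = 0 := by
  simp [koszulContr, h]

theorem contr_of_notMem {k : Fin n} {L : Finset (Fin n)} (m : Finset (Fin n) → M) (h : k ∉ L) :
    koszulContr n k m L = sign k L • m (insert k L) := by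
  simp [koszulContr, h, sign]

theorem wedge_insert {j : Fin n} {L : Finset (Fin n)} (m : Finset (Fin n) → M) (h : j ∉ L) :
    wedge j m (insert j L) = sign j L • m L := by
  simp [wedge, h]

theorem wedge_of_notMem {j : Fin n} {L : Finset (Fin n)} (m : Finset (Fin n) → M) (h : j ∉ L) :
    wedge j m L = 0 := by
  simp [wedge, h]

theorem contr_zero (j : Fin n) : koszulContr n j (0 : Finset (Fin n) → M) = 0 := by
  funext L
  simp [koszulContr]

theorem wedge_zero (j : Fin n) : wedge j (0 : Finset (Fin n) → M) = 0 := by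
  funext L
  simp [wedge]

theorem contr_contr (j k : Fin n) (m : Finset (Fin n) → M) :
    koszulContr n k (koszulContr n j m) = -koszulContr n j (koszulContr n k m) := by
  funext L
  rw [Pi.neg_apply]
  by_cases hk : k ∈ L
  · rw [contr_of_mem _ hk]
    by_cases hj : j ∈ L
    · simp [contr_of_mem _ hj]
    · rw [contr_of_notMem _ hj, contr_of_mem _ (mem_insert_of_mem hk)]
      simp
  · by_cases hj : j ∈ L
    · rw [contr_of_mem _ hj, contr_of_notMem _ hk, contr_of_mem _ (mem_insert_of_mem hj)]
      simp
    · by_cases hjk : j = k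
      · subst hjk
        rw [contr_of_notMem _ hj, contr_of_mem _ (mem_insert_self _ _)]
        simp
      · rw [contr_of_notMem _ hk, contr_of_notMem _ hj,
          contr_of_notMem _ (show j ∉ insert k L by simp [hj, hjk]),
          contr_of_notMem _ (show k ∉ insert j L by simp [hk, Ne.symm hjk]),
          smul_smul, smul_smul, insert_comm, sign_mul_sign_insert' hjk hj hk, neg_smul]

theorem contr_wedge_of_ne {j k : Fin n} (hjk : j ≠ k) (m : Finset (Fin n) → M) :
    koszulContr n k (wedge j m) = -wedge j (koszulContr n k m) := by
  funext L
  rw [Pi.neg_apply]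
  by_cases hj : j ∈ L
  · obtain ⟨L, hj', rfl⟩ : ∃ L', j ∉ L' ∧ insert j L' = L :=
      ⟨L.erase j, notMem_erase _ _, insert_erase hj⟩
    rw [wedge_insert _ hj']
    by_cases hk : k ∈ L
    · rw [contr_of_mem _ hk, contr_of_mem _ (mem_insert_of_mem hk)]
      simp
    · rw [contr_of_notMem _ hk,
        contr_of_notMem _ (show k ∉ insert j L by simp [hk, Ne.symm hjk]), insert_comm,
        wedge_insert _ (show j ∉ insert k L by simp [hj', hjk]), smul_smul, smul_smul,
        sign_mul_sign_insert hjk hj' hk, neg_smul, mul_comm]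
  · rw [wedge_of_notMem _ hj]
    by_cases hk : k ∈ L
    · rw [contr_of_mem _ hk]
      simp
    · rw [contr_of_notMem _ hk, wedge_of_notMem _ (by simp [hj, hjk])]
      simp

theorem contr_wedge_self (j : Fin n) (m : Finset (Fin n) → M) :
    koszulContr n j (wedge j m) = m - wedge j (koszulContr n j m) := by
  funext L
  rw [Pi.sub_apply]
  by_cases hj : j ∈ L
  · obtain ⟨L, hj', rfl⟩ : ∃ L', j ∉ L' ∧ insert j L' = L :=
      ⟨L.erase j, notMem_erase _ _, insert_erase hj⟩
    rw [wedge_insert _ hj', contr_of_mem _ hj, contr_of_notMem _ hj', smul_smul, sign_mul_self]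
    simp
  · rw [wedge_of_notMem _ hj, contr_of_notMem _ hj, wedge_insert _ hj, smul_smul, sign_mul_self]
    simp

variable [Module (MvPolynomial (Fin n) K) M]

theorem contr_sum_smul (j : Fin n) (f : Fin n → Finset (Fin n) → M) :
    koszulContr n j (∑ k, (X k : MvPolynomial (Fin n) K) • f k) =
      ∑ k, (X k : MvPolynomial (Fin n) K) • koszulContr n j (f k) := by
  funext L
  by_cases hj : j ∈ L
  · simp [contr_of_mem _ hj]
  · simp [contr_of_notMem _ hj, smul_sum, smul_comm (sign j L)]

theorem wedge_sum_smul (j : Fin n) (f : Fin n → Finset (Fin n) → M) :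
    wedge j (∑ k, (X k : MvPolynomial (Fin n) K) • f k) =
      ∑ k, (X k : MvPolynomial (Fin n) K) • wedge j (f k) := by
  funext L
  by_cases hj : j ∈ L
  · simp [wedge, hj, smul_sum, smul_comm (sign j (L.erase j))]
  · simp [wedge, hj]

variable [Module K M] [IsScalarTower K (MvPolynomial (Fin n) K) M]

theorem koszulD_eq_sum (m : Finset (Fin n) → M) :
    koszulD n (K := K) m =
      ∑ k, (X k : MvPolynomial (Fin n) K) • koszulContr n k m := by
  funext L
  rw [Finset.sum_apply, ← sum_subset (subset_univ Lᶜ)]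
  · refine sum_congr rfl fun k hk => ?_
    rw [Pi.smul_apply, contr_of_notMem m (by simpa using hk), smul_comm]
    rfl
  · intro k _ hk
    simp [contr_of_mem m (show k ∈ L by simpa using hk)]

theorem koszulD_contr (j : Fin n) (m : Finset (Fin n) → M) :
    koszulD n (K := K) (koszulContr n j m) = -koszulContr n j (koszulD n (K := K) m) := by
  rw [koszulD_eq_sum, koszulD_eq_sum, contr_sum_smul, ← sum_neg_distrib]
  refine sum_congr rfl fun k _ => ?_
  rw [contr_contr, smul_neg]

theorem koszulD_wedge (j : Fin n) (m : Finset (Fin n) → M) :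
    koszulD n (K := K) (wedge j m) =
      (X j : MvPolynomial (Fin n) K) • m - wedge j (koszulD n (K := K) m) := by
  rw [koszulD_eq_sum, koszulD_eq_sum, wedge_sum_smul, eq_sub_iff_add_eq, ← sum_add_distrib,
    sum_eq_single j]
  · rw [contr_wedge_self, ← smul_add, sub_add_cancel]
  · intro k _ hk
    rw [contr_wedge_of_ne (Ne.symm hk), ← smul_add, neg_add_cancel, smul_zero]
  · simp

theorem koszulD_X_smul (j : Fin n) (m : Finset (Fin n) → M) :
    koszulD n (K := K) ((X j : MvPolynomial (Fin n) K) • m) =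
      (X j : MvPolynomial (Fin n) K) • koszulD n (K := K) m := by
  funext L
  simp only [koszulD, LinearMap.coe_mk, AddHom.coe_mk, Pi.smul_apply, smul_sum]
  refine sum_congr rfl fun k _ => ?_
  rw [smul_comm (X j : MvPolynomial (Fin n) K) ((-1 : ℤ) ^ _),
    smul_comm (X j : MvPolynomial (Fin n) K) (X k : MvPolynomial (Fin n) K)]

end Operators

section Chains

variable {n : ℕ} {K : Type*} [Field K] {M : Type*} [AddCommGroup M] [Module K M]

/-- Koszul chains on the variables in `A`, of homological degree `i` and internal degree `t`. -/
def chains (gr : ℤ → Submodule K M) (i : ℕ) (t : ℤ) (A : Finset (Fin n)) :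
    Submodule K (Finset (Fin n) → M) where
  carrier := {m | ∀ J, m J ∈ gr t ∧ (¬(J.card = i ∧ J ⊆ A) → m J = 0)}
  zero_mem' := fun _ => ⟨(gr t).zero_mem, fun _ => rfl⟩
  add_mem' ha hb J := ⟨(gr t).add_mem (ha J).1 (hb J).1, fun h => by
    simp [(ha J).2 h, (hb J).2 h]⟩
  smul_mem' c _ ha J := ⟨(gr t).smul_mem c (ha J).1, fun h => by simp [(ha J).2 h]⟩

variable {gr : ℤ → Submodule K M} {i : ℕ} {t : ℤ} {A B : Finset (Fin n)}
  {m : Finset (Fin n) → M}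

theorem koszulC_eq_chains (gr : ℤ → Submodule K M) (i : ℕ) (t : ℤ) :
    koszulC n gr i t n = chains gr i t univ := by
  ext m
  simp [koszulC, chains]

theorem chains_mono (h : A ⊆ B) : chains gr i t A ≤ chains gr i t B :=
  fun _ hm J => ⟨(hm J).1, fun hJ => (hm J).2 fun h' => hJ ⟨h'.1, h'.2.trans h⟩⟩

theorem contr_mem_chains (j : Fin n) (hm : m ∈ chains gr (i + 1) t A) :
    koszulContr n j m ∈ chains gr i t (A.erase j) := by
  intro J
  by_cases hj : j ∈ J
  · simp [contr_of_mem _ hj]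
  · rw [contr_of_notMem _ hj]
    refine ⟨zsmul_mem (hm _).1 _, fun hJ => ?_⟩
    rw [(hm _).2, smul_zero]
    rintro ⟨h1, h2⟩
    rw [card_insert_of_notMem hj] at h1
    exact hJ ⟨by omega, subset_erase.2 ⟨(subset_insert _ _).trans h2, hj⟩⟩

theorem wedge_mem_chains {j : Fin n} (hj : j ∈ A) (hm : m ∈ chains gr i t A) :
    wedge j m ∈ chains gr (i + 1) t A := by
  intro J
  by_cases hJ : j ∈ J
  · simp only [wedge, hJ, if_true]
    refine ⟨zsmul_mem (hm _).1 _, fun h => ?_⟩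
    rw [(hm _).2, smul_zero]
    rintro ⟨h1, h2⟩
    refine h ⟨?_, ?_⟩
    · rw [← h1, card_erase_add_one hJ]
    · rw [← insert_erase hJ]
      exact insert_subset hj h2
  · simp [wedge_of_notMem _ hJ]

theorem sub_wedge_contr_mem_chains {j : Fin n} (hj : j ∈ A) (hm : m ∈ chains gr i t A) :
    m - wedge j (koszulContr n j m) ∈ chains gr i t (A.erase j) := by
  rw [← contr_wedge_self]
  exact contr_mem_chains j (wedge_mem_chains hj hm)

theorem contr_eq_zero_of_mem_chains_erase {j : Fin n} (hm : m ∈ chains gr i t (A.erase j)) :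
    koszulContr n j m = 0 := by
  funext L
  by_cases hj : j ∈ L
  · simp [contr_of_mem _ hj]
  · rw [contr_of_notMem _ hj, (hm _).2, smul_zero, Pi.zero_apply]
    rintro ⟨-, h⟩
    exact notMem_erase j A (h (mem_insert_self j L))

theorem card_le_of_mem_chains (hm : m ∈ chains gr i t A) (h0 : m ≠ 0) : i ≤ A.card := by
  by_contra h
  refine h0 (funext fun J => (hm J).2 ?_)
  rintro ⟨h1, h2⟩
  have := card_le_card h2
  omega

variable [Module (MvPolynomial (Fin n) K) M]

theorem X_smul_mem_chains
    (hX : ∀ (k : Fin n) (l : ℤ), ∀ x ∈ gr (l - 1), (X k : MvPolynomial (Fin n) K) • x ∈ gr l)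
    (j : Fin n) (hm : m ∈ chains gr i (t - 1) A) :
    (X j : MvPolynomial (Fin n) K) • m ∈ chains gr i t A :=
  fun J => ⟨hX _ _ _ (hm J).1, fun h => by simp [(hm J).2 h]⟩

variable [IsScalarTower K (MvPolynomial (Fin n) K) M]

/-- Vanishing of Koszul homology on the variables in `A`, in homological degree `i` and
internal degree `t`. -/
def ExactAt (gr : ℤ → Submodule K M) (i : ℕ) (t : ℤ) (A : Finset (Fin n)) : Prop :=
  ∀ z ∈ chains gr i t A, koszulD n (K := K) z = 0 →
    ∃ w ∈ chains gr (i + 1) (t - 1) A, koszulD n (K := K) w = z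

theorem exists_bounding_erase
    (hX : ∀ (k : Fin n) (l : ℤ), ∀ x ∈ gr (l - 1), (X k : MvPolynomial (Fin n) K) • x ∈ gr l)
    {j : Fin n} (hj : j ∈ A) (hA : ExactAt gr i (t - 1) (A.erase j))
    {z w : Finset (Fin n) → M} (hz : z ∈ chains gr i t (A.erase j))
    (hw : w ∈ chains gr (i + 1) (t - 1) A) (hwz : koszulD n (K := K) w = z) :
    ∃ w' ∈ chains gr (i + 1) (t - 1) (A.erase j), koszulD n (K := K) w' = z := by
  have hcycle : koszulD n (K := K) (koszulContr n j w) = 0 := by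
    rw [koszulD_contr, hwz, contr_eq_zero_of_mem_chains_erase hz, neg_zero]
  obtain ⟨u, hu, hdu⟩ := hA _ (contr_mem_chains j hw) hcycle
  refine ⟨w - wedge j (koszulContr n j w) + (X j : MvPolynomial (Fin n) K) • u,
    add_mem (sub_wedge_contr_mem_chains hj hw) (X_smul_mem_chains hX j hu), ?_⟩
  rw [map_add, map_sub, koszulD_wedge, koszulD_X_smul, hcycle, hdu, hwz, wedge_zero]
  abel

theorem exists_cycle_erase
    (hX : ∀ (k : Fin n) (l : ℤ), ∀ x ∈ gr (l - 1), (X k : MvPolynomial (Fin n) K) • x ∈ gr l)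
    {j : Fin n} (hj : j ∈ A) {z u : Finset (Fin n) → M}
    (hz : z ∈ chains gr (i + 1) t A) (hdz : koszulD n (K := K) z = 0)
    (hu : u ∈ chains gr (i + 1) (t - 1) (A.erase j))
    (hdu : koszulD n (K := K) u = koszulContr n j z) :
    ∃ z' ∈ chains gr (i + 1) t (A.erase j), koszulD n (K := K) z' = 0 ∧
      ∃ v ∈ chains gr (i + 2) (t - 1) A, z = z' + koszulD n (K := K) v := by
  refine ⟨z - wedge j (koszulContr n j z) + (X j : MvPolynomial (Fin n) K) • u,
    add_mem (sub_wedge_contr_mem_chains hj hz) (X_smul_mem_chains hX j hu), ?_,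
    -wedge j u, neg_mem (wedge_mem_chains hj (chains_mono (erase_subset _ _) hu)), ?_⟩
  · have hd : koszulD n (K := K) (koszulContr n j z) = 0 := by
      rw [koszulD_contr, hdz, contr_zero, neg_zero]
    rw [map_add, map_sub, koszulD_wedge, koszulD_X_smul, hd, hdu, hdz, wedge_zero]
    abel
  · rw [map_neg, koszulD_wedge, hdu]
    abel

theorem exactAt_of_lt_zero (hneg : ∀ l < 0, gr l = ⊥) (ht : t < 0) : ExactAt gr i t A := by
  intro z hz _
  refine ⟨0, zero_mem _, ?_⟩
  have : z = 0 := funext fun J => by simpa [hneg t ht] using (hz J).1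
  simp [this]

theorem exactAt_of_univ
    (hX : ∀ (k : Fin n) (l : ℤ), ∀ x ∈ gr (l - 1), (X k : MvPolynomial (Fin n) K) • x ∈ gr l)
    (hneg : ∀ l < 0, gr l = ⊥) (h : ∀ l < t, ExactAt gr i l (univ : Finset (Fin n)))
    (A : Finset (Fin n)) : ∀ l < t, ExactAt gr i l A := by
  rw [← compl_compl A]
  induction Aᶜ using Finset.induction_on with
  | empty => simpa using h
  | insert j S hj ih =>
    rw [compl_insert]
    suffices H : ∀ (N : ℕ) (l : ℤ), l < N → l < t → ExactAt gr i l (Sᶜ.erase j) from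
      fun l hl => H (l.toNat + 1) l (by omega) hl
    intro N
    induction N with
    | zero => exact fun l hl _ => exactAt_of_lt_zero hneg (by simpa using hl)
    | succ N ihN =>
      intro l hl hlt z hz hdz
      obtain ⟨w, hw, hwz⟩ := ih l hlt z (chains_mono (erase_subset _ _) hz) hdz
      exact exists_bounding_erase hX (by simpa using hj)
        (ihN (l - 1) (by push_cast at hl; omega) (by omega)) hz hw hwz

theorem exactAt_succ
    (hX : ∀ (k : Fin n) (l : ℤ), ∀ x ∈ gr (l - 1), (X k : MvPolynomial (Fin n) K) • x ∈ gr l)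
    (h : ∀ A : Finset (Fin n), ExactAt gr i t A) (A : Finset (Fin n)) :
    ExactAt gr (i + 1) t A := by
  induction A using Finset.induction_on with
  | empty =>
    intro z hz _
    refine ⟨0, zero_mem _, ?_⟩
    by_contra h0
    have := card_le_of_mem_chains hz fun hz0 => h0 (by rw [map_zero, hz0])
    simp at this
  | insert j A hj ih =>
    intro z hz hdz
    have hz1 := contr_mem_chains j hz
    obtain ⟨u, hu, hdu⟩ := h _ _ hz1 (by
      rw [koszulD_contr, hdz, contr_zero, neg_zero])
    obtain ⟨z', hz', hdz', v, hv, rfl⟩ :=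
      exists_cycle_erase hX (mem_insert_self j A) hz hdz hu hdu
    rw [erase_insert hj] at hz'
    obtain ⟨w, hw, rfl⟩ := ih z' hz' hdz'
    exact ⟨w + v, add_mem (chains_mono (subset_insert _ _) hw) hv, map_add _ _ _⟩

theorem exactAt_of_le
    (hX : ∀ (k : Fin n) (l : ℤ), ∀ x ∈ gr (l - 1), (X k : MvPolynomial (Fin n) K) • x ∈ gr l)
    {k : ℕ} (h : ∀ A : Finset (Fin n), ExactAt gr k t A) (hki : k ≤ i) :
    ∀ A : Finset (Fin n), ExactAt gr i t A := by
  induction i, hki using Nat.le_induction with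
  | base => exact h
  | succ i _ ih => exact exactAt_succ hX ih

theorem exists_bounding_of_univ
    (hX : ∀ (k : Fin n) (l : ℤ), ∀ x ∈ gr (l - 1), (X k : MvPolynomial (Fin n) K) • x ∈ gr l)
    (h : ∀ A : Finset (Fin n), ExactAt gr i (t - 1) A) {z : Finset (Fin n) → M}
    (hz : z ∈ chains gr i t A)
    (hB : ∃ w ∈ chains gr (i + 1) (t - 1) univ, koszulD n (K := K) w = z) :
    ∃ w ∈ chains gr (i + 1) (t - 1) A, koszulD n (K := K) w = z := by
  rw [← compl_compl A] at hz ⊢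
  revert hz
  induction Aᶜ using Finset.induction_on with
  | empty => exact fun _ => by simpa using hB
  | insert j S hj ih =>
    rw [compl_insert]
    intro hz
    obtain ⟨w, hw, hwz⟩ := ih (chains_mono (erase_subset _ _) hz)
    exact exists_bounding_erase hX (by simpa using hj) (h _) hz hw hwz

end Chains

section Multidegree

/-- The multidegree `ε_L` of the exterior monomial `e_L`. -/
def indicatorDegree {n : ℕ} (L : Finset (Fin n)) : Fin n → ℤ := fun i => if i ∈ L then 1 else 0

theorem indicatorDegree_insert {n : ℕ} {k : Fin n} {L : Finset (Fin n)} (h : k ∉ L) :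
    indicatorDegree (insert k L) = indicatorDegree L + Pi.single k 1 := by
  funext i
  by_cases hi : i = k
  · subst hi
    simp [indicatorDegree, h]
  · simp [indicatorDegree, hi]

theorem indicatorDegree_injective {n : ℕ} :
    Function.Injective (indicatorDegree : Finset (Fin n) → Fin n → ℤ) := by
  intro A B h
  ext i
  have := congrFun h i
  by_cases hA : i ∈ A <;> by_cases hB : i ∈ B <;> simp_all [indicatorDegree]

variable {n : ℕ} {K : Type*} [Field K] {M : Type*} [AddCommGroup M] [Module K M]
  [Module (MvPolynomial (Fin n) K) M]

/-- The projections onto the components of a `ℤⁿ`-grading refining the grading `gr`. -/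
structure Multigrading (gr : ℤ → Submodule K M) where
  /-- The projection onto the component of a given multidegree. -/
  comp : (Fin n → ℤ) → M →ₗ[K] M
  comp_mem : ∀ b l, ∀ x ∈ gr l, comp b x ∈ gr l
  comp_X_smul : ∀ b k x, comp b ((X k : MvPolynomial (Fin n) K) • x) =
    (X k : MvPolynomial (Fin n) K) • comp (b - Pi.single k 1) x
  comp_comp : ∀ b c x, comp b (comp c x) = if b = c then comp c x else 0
  exists_sum_eq : ∀ x, ∃ T : Finset (Fin n → ℤ), ∀ T', T ⊆ T' → ∑ b ∈ T', comp b x = x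

variable {gr : ℤ → Submodule K M} (P : Multigrading (n := n) gr) {i : ℕ} {t : ℤ}
  {A : Finset (Fin n)}

/-- The projection of the Koszul complex onto its component of multidegree `a`. -/
def Multigrading.proj (a : Fin n → ℤ) : (Finset (Fin n) → M) →ₗ[K] (Finset (Fin n) → M) :=
  LinearMap.pi fun L => P.comp (a - indicatorDegree L) ∘ₗ LinearMap.proj L

namespace Multigrading

theorem proj_apply (a : Fin n → ℤ) (m : Finset (Fin n) → M) (L : Finset (Fin n)) :
    P.proj a m L = P.comp (a - indicatorDegree L) (m L) := rfl

theorem proj_mem_chains (a : Fin n → ℤ) {m : Finset (Fin n) → M} (hm : m ∈ chains gr i t A) :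
    P.proj a m ∈ chains gr i t A :=
  fun J => ⟨P.comp_mem _ _ _ (hm J).1, fun h => by rw [proj_apply, (hm J).2 h, map_zero]⟩

theorem proj_proj (a b : Fin n → ℤ) (m : Finset (Fin n) → M) :
    P.proj a (P.proj b m) = if a = b then P.proj b m else 0 := by
  funext L
  rw [proj_apply, proj_apply, P.comp_comp]
  simp only [sub_left_inj]
  split_ifs <;> rfl

theorem proj_contr (b : Fin n → ℤ) (j : Fin n) (m : Finset (Fin n) → M) :
    P.proj b (koszulContr n j m) = koszulContr n j (P.proj (b + Pi.single j 1) m) := by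
  funext L
  rw [proj_apply]
  by_cases hj : j ∈ L
  · simp [contr_of_mem _ hj]
  · rw [contr_of_notMem _ hj, contr_of_notMem _ hj, map_zsmul, proj_apply,
      indicatorDegree_insert hj, add_sub_add_right_eq_sub]

theorem exists_sum_proj_eq (m : Finset (Fin n) → M) :
    ∃ T : Finset (Fin n → ℤ), ∑ a ∈ T, P.proj a m = m := by
  choose T hT using fun L => P.exists_sum_eq (m L)
  let U : Finset (Fin n → ℤ) := univ.biUnion fun L => (T L).image (· + indicatorDegree L)
  refine ⟨U, funext fun L => ?_⟩
  rw [Finset.sum_apply]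
  refine Eq.trans ?_ (hT L (U.image (· - indicatorDegree L)) fun b hb => ?_)
  · rw [sum_image (fun a _ b _ h => sub_left_injective h)]
    rfl
  · exact mem_image.2 ⟨b + indicatorDegree L, mem_biUnion.2
      ⟨L, mem_univ _, mem_image_of_mem _ hb⟩, add_sub_cancel_right _ _⟩

variable [IsScalarTower K (MvPolynomial (Fin n) K) M]

theorem proj_koszulD (a : Fin n → ℤ) (m : Finset (Fin n) → M) :
    P.proj a (koszulD n (K := K) m) = koszulD n (K := K) (P.proj a m) := by
  funext L
  simp only [proj_apply, koszulD, LinearMap.coe_mk, AddHom.coe_mk, map_sum, map_zsmul,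
    P.comp_X_smul]
  refine sum_congr rfl fun k hk => ?_
  rw [indicatorDegree_insert (by simpa using hk), sub_sub]

end Multigrading

/-- `z` is a cycle on the variables in `A` that does not bound in the full Koszul complex. -/
def Essential (gr : ℤ → Submodule K M) [IsScalarTower K (MvPolynomial (Fin n) K) M]
    (i : ℕ) (t : ℤ) (A : Finset (Fin n)) (z : Finset (Fin n) → M) : Prop :=
  z ∈ chains gr i t A ∧ koszulD n (K := K) z = 0 ∧
    ¬ ∃ w ∈ chains gr (i + 1) (t - 1) univ, koszulD n (K := K) w = z

variable [IsScalarTower K (MvPolynomial (Fin n) K) M]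

theorem Essential.mono {B : Finset (Fin n)} {z : Finset (Fin n) → M}
    (hz : Essential gr i t A z) (h : A ⊆ B) : Essential gr i t B z :=
  ⟨chains_mono h hz.1, hz.2⟩

theorem Essential.exists_proj {z : Finset (Fin n) → M} (hz : Essential gr i t A z) :
    ∃ a, Essential gr i t A (P.proj a z) := by
  by_contra! h
  have hB : ∀ a, ∃ w ∈ chains gr (i + 1) (t - 1) univ, koszulD n (K := K) w = P.proj a z := by
    intro a
    by_contra ha
    exact h a ⟨P.proj_mem_chains a hz.1, by rw [← P.proj_koszulD, hz.2.1, map_zero], ha⟩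
  choose w hw hwz using hB
  obtain ⟨T, hT⟩ := P.exists_sum_proj_eq z
  exact hz.2.2 ⟨∑ a ∈ T, w a, sum_mem fun a _ => hw a, by simp only [map_sum, hwz, hT]⟩

/-- An essential homogeneous cycle is homologous to one all of whose contractions, along the
variables it involves, are essential. -/
theorem Essential.exists_contr_essential
    (hX : ∀ (k : Fin n) (l : ℤ), ∀ x ∈ gr (l - 1), (X k : MvPolynomial (Fin n) K) • x ∈ gr l)
    (h : ∀ A : Finset (Fin n), ExactAt gr i (t - 1) A) (b : Fin n → ℤ) :
    ∀ (A : Finset (Fin n)) (z : Finset (Fin n) → M), Essential gr (i + 1) t A z →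
      P.proj b z = z → ∃ A' ⊆ A, i + 1 ≤ A'.card ∧ ∀ j ∈ A', ∃ y,
        Essential gr i t (A'.erase j) y ∧ P.proj (b - Pi.single j 1) y = y := by
  intro A
  induction A using Finset.strongInduction with
  | H A ih =>
    intro z hz hbz
    by_cases hall : ∀ j ∈ A, Essential gr i t (A.erase j) (koszulContr n j z)
    · refine ⟨A, Subset.rfl, card_le_of_mem_chains hz.1 ?_, fun j hj => ⟨_, hall j hj, ?_⟩⟩
      · rintro rfl
        exact hz.2.2 ⟨0, zero_mem _, map_zero _⟩
      · rw [P.proj_contr, sub_add_cancel, hbz]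
    · push Not at hall
      obtain ⟨j, hj, hnot⟩ := hall
      have hzj := contr_mem_chains j hz.1
      have hB : ∃ w ∈ chains gr (i + 1) (t - 1) univ,
          koszulD n (K := K) w = koszulContr n j z := by
        by_contra hB
        exact hnot ⟨hzj, by rw [koszulD_contr, hz.2.1, contr_zero, neg_zero], hB⟩
      obtain ⟨u, hu, hdu⟩ := exists_bounding_of_univ hX h hzj hB
      obtain ⟨z', hz', hdz', v, hv, hzv⟩ := exists_cycle_erase hX hj hz.1 hz.2.1 hu hdu
      have hess : Essential gr (i + 1) t (A.erase j) (P.proj b z') := by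
        refine ⟨P.proj_mem_chains b hz', by rw [← P.proj_koszulD, hdz', map_zero], ?_⟩
        rintro ⟨w, hw, hwz⟩
        refine hz.2.2 ⟨w + P.proj b v, add_mem hw
          (P.proj_mem_chains b (chains_mono (subset_univ _) hv)), ?_⟩
        rw [map_add, hwz, ← P.proj_koszulD, ← map_add, ← hzv, hbz]
      obtain ⟨A', hA', hcard, hext⟩ :=
        ih _ (erase_ssubset hj) _ hess (by rw [P.proj_proj, if_pos rfl])
      exact ⟨A', hA'.trans (erase_subset _ _), hcard, hext⟩

open Classical in
/-- The sets `J` of size `s` such that there is an essential cycle of multidegree `a - ε_J`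
not involving the variables in `J`. -/
noncomputable def essentialFaces (a : Fin n → ℤ) (t : ℤ) (p s : ℕ) : Finset (Finset (Fin n)) :=
  univ.filter fun J => J.card = s ∧
    ∃ y, Essential gr (p - s) t Jᶜ y ∧ P.proj (a - indicatorDegree J) y = y

theorem choose_le_card_essentialFaces
    (hX : ∀ (k : Fin n) (l : ℤ), ∀ x ∈ gr (l - 1), (X k : MvPolynomial (Fin n) K) • x ∈ gr l)
    {k p : ℕ} (h : ∀ i, k ≤ i → ∀ A : Finset (Fin n), ExactAt gr i (t - 1) A)
    {a : Fin n → ℤ} {z : Finset (Fin n) → M} (hz : Essential gr p t univ z)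
    (haz : P.proj a z = z) (s : ℕ) (hs : s + k ≤ p) :
    p.choose s ≤ (essentialFaces P a t p s).card := by
  classical
  induction s with
  | zero =>
    rw [Nat.choose_zero_right, Nat.one_le_iff_ne_zero, ← Nat.pos_iff_ne_zero, card_pos]
    refine ⟨∅, mem_filter.2 ⟨mem_univ _, rfl, z, by simpa using hz, ?_⟩⟩
    have : indicatorDegree (∅ : Finset (Fin n)) = 0 := by
      funext i
      simp [indicatorDegree]
    rw [this, sub_zero, haz]
  | succ s ih =>
    have hcount : (essentialFaces P a t p s).card * (p - s) ≤
        (essentialFaces P a t p (s + 1)).card * (s + 1) := by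
      refine card_mul_le_card_mul (fun J J' : Finset (Fin n) => J ⊆ J') (fun J hJ => ?_)
        fun J' hJ' => ?_
      · obtain ⟨-, hJs, y, hy, hay⟩ := mem_filter.1 hJ
        obtain ⟨q, hq⟩ : ∃ q, p - s = q + 1 := ⟨p - s - 1, by omega⟩
        rw [hq] at hy ⊢
        obtain ⟨A', hA', hcard, hext⟩ :=
          hy.exists_contr_essential P hX (h q (by omega)) _ Jᶜ y hay
        have hdisj : ∀ j ∈ A', j ∉ J := fun j hj => mem_compl.1 (hA' hj)
        rw [← card_image_of_injOn (s := A') (f := fun j => insert j J)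
          fun j hj j' _ hjj' => (mem_insert.1 ((Finset.ext_iff.1 hjj' j).1
            (mem_insert_self j J))).resolve_right (hdisj j hj)] at hcard
        refine hcard.trans (card_le_card ?_)
        intro J' hJ'
        obtain ⟨j, hj, rfl⟩ := mem_image.1 hJ'
        obtain ⟨y', hy', hay'⟩ := hext j hj
        refine mem_filter.2 ⟨mem_filter.2 ⟨mem_univ _, ?_, y', ?_, ?_⟩, subset_insert _ _⟩
        · rw [card_insert_of_notMem (hdisj j hj), hJs]
        · rw [show p - (s + 1) = q by omega]
          refine hy'.mono ?_
          rw [compl_insert]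
          exact erase_subset_erase _ hA'
        · rw [indicatorDegree_insert (hdisj j hj), ← sub_sub, hay']
      · obtain ⟨-, hJs, -⟩ := mem_filter.1 hJ'
        have hsub : bipartiteBelow (fun J J' : Finset (Fin n) => J ⊆ J')
            (essentialFaces P a t p s) J' ⊆ J'.powersetCard s := by
          intro J hJ
          obtain ⟨hJ1, hJ2⟩ := mem_filter.1 hJ
          exact mem_powersetCard.2 ⟨hJ2, (mem_filter.1 hJ1).2.1⟩
        refine (card_le_card hsub).trans ?_
        rw [card_powersetCard, hJs, Nat.choose_succ_self_right]
    refine Nat.le_of_mul_le_mul_right ?_ (Nat.succ_pos s)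
    rw [Nat.choose_succ_right_eq]
    exact (Nat.mul_le_mul_right _ (ih (by omega))).trans hcount

theorem card_essentialFaces_le_rank (a : Fin n → ℤ) (p s : ℕ)
    {B Z : Submodule K (Finset (Fin n) → M)}
    (hZ : ∀ z, z ∈ chains gr (p - s) t univ → koszulD n (K := K) z = 0 → z ∈ Z)
    (hB : ∀ z, z ∈ B ↔ ∃ w ∈ chains gr (p - s + 1) (t - 1) univ, koszulD n (K := K) w = z) :
    ((essentialFaces P a t p s).card : Cardinal) ≤ Module.rank K (Z ⧸ B.comap Z.subtype) := by
  classical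
  have hface : ∀ J : essentialFaces P a t p s, ∃ y, Essential gr (p - s) t univ y ∧
      P.proj (a - indicatorDegree J.1) y = y := fun J => by
    obtain ⟨-, -, y, hy, hay⟩ := mem_filter.1 J.2
    exact ⟨y, hy.mono (subset_univ _), hay⟩
  choose y hy hay using hface
  let v : essentialFaces P a t p s → Z ⧸ B.comap Z.subtype := fun J =>
    Submodule.Quotient.mk ⟨y J, hZ _ (hy J).1 (hy J).2.1⟩
  have hv : LinearIndependent K v := by
    rw [Fintype.linearIndependent_iff]
    intro c hc J
    have hmem : ∑ J, c J • y J ∈ B := by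
      have : (Submodule.Quotient.mk (∑ J, c J • (⟨y J, hZ _ (hy J).1 (hy J).2.1⟩ : Z)) :
          Z ⧸ B.comap Z.subtype) = 0 := by
        rw [← hc]
        simp only [v, ← Submodule.mkQ_apply, map_sum, map_smul]
      rw [Submodule.Quotient.mk_eq_zero] at this
      simpa using this
    obtain ⟨w, hw, hdw⟩ := (hB _).1 hmem
    have hproj : koszulD n (K := K) (P.proj (a - indicatorDegree J.1) w) = c J • y J := by
      rw [← P.proj_koszulD, hdw, map_sum, sum_eq_single J]
      · rw [map_smul, hay]
      · intro J' _ hJ'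
        rw [map_smul, ← hay J', P.proj_proj, if_neg, smul_zero]
        intro heq
        exact hJ' (Subtype.ext (indicatorDegree_injective (sub_right_injective heq)).symm)
      · simp
    by_contra hcJ
    refine (hy J).2.2 ⟨(c J)⁻¹ • P.proj (a - indicatorDegree J.1) w,
      Submodule.smul_mem _ _ (P.proj_mem_chains _ hw), ?_⟩
    rw [map_smul, hproj, smul_smul, inv_mul_cancel₀ hcJ, one_smul]
  simpa using hv.cardinal_lift_le_rank

end Multidegree

section NatGrading

variable {n : ℕ} {K : Type*} [Field K] {M : Type*} [AddCommGroup M] [Module K M]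

theorem totalGrading_eq_bot (gr : (Fin n → ℕ) → Submodule K M) {l : ℤ} (hl : l < 0) :
    totalGrading gr l = ⊥ := by
  refine le_bot_iff.1 (iSup₂_le fun a ha => ?_)
  have : 0 ≤ ∑ i, (a i : ℤ) := sum_nonneg fun i _ => Int.natCast_nonneg _
  omega

theorem X_smul_mem_totalGrading [Module (MvPolynomial (Fin n) K) M]
    [IsScalarTower K (MvPolynomial (Fin n) K) M] (gr : (Fin n → ℕ) → Submodule K M)
    (hcompat : ∀ (i : Fin n) (a : Fin n → ℕ), ∀ m ∈ gr a,
      (X i : MvPolynomial (Fin n) K) • m ∈ gr (a + Pi.single i 1))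
    (k : Fin n) (l : ℤ) (x : M) (hx : x ∈ totalGrading gr (l - 1)) :
    (X k : MvPolynomial (Fin n) K) • x ∈ totalGrading gr l := by
  suffices h : totalGrading gr (l - 1) ≤
      (totalGrading gr l).comap (Module.toModuleEnd K (S := MvPolynomial (Fin n) K) M (X k)) from
    h hx
  refine iSup₂_le fun a ha m hm => ?_
  refine Submodule.mem_iSup_of_mem (a + Pi.single k 1)
    (Submodule.mem_iSup_of_mem ?_ (hcompat k a m hm))
  simp [sum_add_distrib, ha, Pi.single_apply]

open Classical in
/-- The projection of an `ℕⁿ`-graded module to its component of degree `b ∈ ℤⁿ`. -/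
noncomputable def natComp (gr : (Fin n → ℕ) → Submodule K M) [DirectSum.Decomposition gr]
    (b : Fin n → ℤ) : M →ₗ[K] M :=
  if 0 ≤ b then
    (gr fun i => (b i).toNat).subtype ∘ₗ DirectSum.component K _ _ (fun i => (b i).toNat) ∘ₗ
      (DirectSum.decomposeLinearEquiv gr).toLinearMap
  else 0

theorem natComp_of_mem (gr : (Fin n → ℕ) → Submodule K M) [DirectSum.Decomposition gr]
    (b : Fin n → ℤ) {c : Fin n → ℕ} {x : M} (hx : x ∈ gr c) :
    natComp gr b x = if b = (fun i => (c i : ℤ)) then x else 0 := by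
  by_cases hb : 0 ≤ b
  · have hb' : b = (fun i => ((b i).toNat : ℤ)) :=
      funext fun i => (Int.toNat_of_nonneg (hb i)).symm
    have key : natComp gr b x = DirectSum.decompose gr x fun i => (b i).toNat := by
      simp only [natComp, if_pos hb]
      rfl
    rw [key]
    split_ifs with h
    · subst h
      simpa using DirectSum.decompose_of_mem_same gr hx
    · refine DirectSum.decompose_of_mem_ne gr hx ?_
      rintro rfl
      exact h hb'
  · rw [natComp, if_neg hb, if_neg, LinearMap.zero_apply]
    rintro rfl
    exact hb fun i => Int.natCast_nonneg _

theorem linearMap_ext_of_decomposition {N : Type*} [AddCommGroup N] [Module K N]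
    (gr : (Fin n → ℕ) → Submodule K M) [DirectSum.Decomposition gr] {f g : M →ₗ[K] N}
    (h : ∀ c, ∀ x ∈ gr c, f x = g x) : f = g := by
  ext x
  induction x using DirectSum.Decomposition.inductionOn gr with
  | zero => simp
  | homogeneous x => exact h _ _ x.2
  | add x y hx hy => rw [map_add, map_add, hx, hy]

/-- The multigrading of an `ℕⁿ`-graded module refining its total grading. -/
noncomputable def natMultigrading [Module (MvPolynomial (Fin n) K) M]
    [IsScalarTower K (MvPolynomial (Fin n) K) M] (gr : (Fin n → ℕ) → Submodule K M)
    [DirectSum.Decomposition gr]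
    (hcompat : ∀ (i : Fin n) (a : Fin n → ℕ), ∀ m ∈ gr a,
      (X i : MvPolynomial (Fin n) K) • m ∈ gr (a + Pi.single i 1)) :
    Multigrading (n := n) (totalGrading gr) where
  comp := natComp gr
  comp_mem b l x hx := by
    suffices h : totalGrading gr l ≤ (totalGrading gr l).comap (natComp gr b) from h hx
    refine iSup₂_le fun a ha m hm => ?_
    rw [Submodule.mem_comap, natComp_of_mem gr b hm]
    split_ifs
    · exact Submodule.mem_iSup_of_mem a (Submodule.mem_iSup_of_mem ha hm)
    · exact zero_mem _
  comp_X_smul b k x := by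
    let f := Module.toModuleEnd K (S := MvPolynomial (Fin n) K) M (X k)
    suffices h : natComp gr b ∘ₗ f = f ∘ₗ natComp gr (b - Pi.single k 1) from
      LinearMap.congr_fun h x
    refine linearMap_ext_of_decomposition gr fun c x hx => ?_
    change natComp gr b ((X k : MvPolynomial (Fin n) K) • x) =
      (X k : MvPolynomial (Fin n) K) • natComp gr (b - Pi.single k 1) x
    rw [natComp_of_mem gr b (hcompat k c x hx), natComp_of_mem gr _ hx, smul_ite, smul_zero]
    refine if_congr ?_ rfl rfl
    rw [sub_eq_iff_eq_add]
    refine Eq.congr_right (funext fun i => ?_)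
    by_cases hi : i = k
    · subst hi
      simp
    · simp [hi]
  comp_comp b c x := by
    suffices h : natComp gr b ∘ₗ natComp gr c = if b = c then natComp gr c else 0 by
      rw [← LinearMap.comp_apply, h]
      split_ifs <;> rfl
    refine linearMap_ext_of_decomposition gr fun d x hx => ?_
    rw [LinearMap.comp_apply, natComp_of_mem gr c hx]
    by_cases hcd : c = fun i => (d i : ℤ)
    · subst hcd
      rw [if_pos rfl, natComp_of_mem gr b hx]
      split_ifs
      · rw [natComp_of_mem gr _ hx, if_pos rfl]
      · rfl
    · rw [if_neg hcd, map_zero]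
      split_ifs
      · rw [natComp_of_mem gr _ hx, if_neg hcd]
      · rfl
  exists_sum_eq x := by
    classical
    induction x using DirectSum.Decomposition.inductionOn gr with
    | zero => exact ⟨∅, fun _ _ => by simp⟩
    | @homogeneous c x =>
      refine ⟨{fun i => (c i : ℤ)}, fun T hT => ?_⟩
      rw [sum_eq_single_of_mem _ (singleton_subset_iff.1 hT)]
      · rw [natComp_of_mem gr _ x.2, if_pos rfl]
      · intro b _ hb
        rw [natComp_of_mem gr _ x.2, if_neg hb]
    | add x y hx hy =>
      obtain ⟨T, hT⟩ := hx
      obtain ⟨U, hU⟩ := hy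
      refine ⟨T ∪ U, fun V hV => ?_⟩
      simp only [map_add, sum_add_distrib]
      rw [hT V (subset_union_left.trans hV), hU V (subset_union_right.trans hV)]

end NatGrading

end KoszulStrand

open MvPolynomial in
/-- Theorem 3.3: for a finitely generated `ℕⁿ`-graded module `M`,
if `H_k^l(n) = 0` for `l < t` and `H_p^t(n) ≠ 0` with `k ≤ p ≤ n`, then
`dim_K H_i^t(n) = β_{i,i+t}(M) ≥ C(p,i)` for `k ≤ i ≤ p`. -/
theorem multigraded_betti_lower_bound {K : Type*} [Field K] {n : ℕ} (hn : 1 ≤ n)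
    {M : Type*} [AddCommGroup M] [Module K M]
    [Module (MvPolynomial (Fin n) K) M] [IsScalarTower K (MvPolynomial (Fin n) K) M]
    [Module.Finite (MvPolynomial (Fin n) K) M]
    (gr : (Fin n → ℕ) → Submodule K M)
    (hdecomp : DirectSum.IsInternal gr)
    (hcompat : ∀ (i : Fin n) (a : Fin n → ℕ), ∀ m ∈ gr a,
      (X i : MvPolynomial (Fin n) K) • m ∈ gr (a + Pi.single i 1))
    (k : ℕ) (hk1 : 1 ≤ k) (hkn : k ≤ n)
    (t : ℕ) (p : ℕ) (hkp : k ≤ p) (hpn : p ≤ n)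
    (hvanish : ∀ l : ℕ, l < t →
      koszulZ n (totalGrading gr) k (l : ℤ) n ≤ koszulB n (totalGrading gr) k (l : ℤ) n)
    (hnonzero : ¬ koszulZ n (totalGrading gr) p (t : ℤ) n ≤
      koszulB n (totalGrading gr) p (t : ℤ) n) :
    ∀ i : ℕ, k ≤ i → i ≤ p → (Nat.choose p i : Cardinal) ≤ Module.rank K
      (koszulZ n (totalGrading gr) i (t : ℤ) n ⧸
        (koszulB n (totalGrading gr) i (t : ℤ) n).comap
          (koszulZ n (totalGrading gr) i (t : ℤ) n).subtype) := by
  intro i hki hip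
  have := hdecomp.chooseDecomposition
  have hX := KoszulStrand.X_smul_mem_totalGrading gr hcompat
  have hneg : ∀ l < 0, totalGrading gr l = ⊥ := fun l hl => KoszulStrand.totalGrading_eq_bot gr hl
  have hex : ∀ l : ℤ, l < t →
      KoszulStrand.ExactAt (totalGrading gr) k l (Finset.univ : Finset (Fin n)) := by
    intro l hl z hz hdz
    rcases lt_or_ge l 0 with h0 | h0
    · exact KoszulStrand.exactAt_of_lt_zero hneg h0 z hz hdz
    · lift l to ℕ using h0
      have := hvanish l (by exact_mod_cast hl)
        ⟨(KoszulStrand.koszulC_eq_chains (totalGrading gr) k l).ge hz, hdz⟩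
      rwa [koszulB, KoszulStrand.koszulC_eq_chains] at this
  have hexact : ∀ i, k ≤ i → ∀ A : Finset (Fin n),
      KoszulStrand.ExactAt (totalGrading gr) i ((t : ℤ) - 1) A := fun i hi =>
    KoszulStrand.exactAt_of_le hX
      (fun A => KoszulStrand.exactAt_of_univ hX hneg hex A _ (by omega)) hi
  obtain ⟨z, ⟨hz, hdz⟩, hzB⟩ := SetLike.not_le_iff_exists.1 hnonzero
  rw [KoszulStrand.koszulC_eq_chains] at hz
  rw [koszulB, KoszulStrand.koszulC_eq_chains] at hzB
  let P := KoszulStrand.natMultigrading gr hcompat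
  have hess : KoszulStrand.Essential (totalGrading gr) p t Finset.univ z := ⟨hz, hdz, hzB⟩
  obtain ⟨a, ha⟩ := hess.exists_proj P
  have hcard := KoszulStrand.choose_le_card_essentialFaces P hX hexact ha
    (by rw [P.proj_proj, if_pos rfl]) (p - i) (by omega)
  rw [Nat.choose_symm hip] at hcard
  refine (Nat.cast_le.2 hcard).trans
    (KoszulStrand.card_essentialFaces_le_rank P a p (p - i) (fun z hz hdz => ?_) fun z => ?_)
  · rw [Nat.sub_sub_self hip] at hz
    exact ⟨by rwa [KoszulStrand.koszulC_eq_chains], hdz⟩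
  · rw [Nat.sub_sub_self hip, koszulB, KoszulStrand.koszulC_eq_chains]
    rfl
end

section
/- Let p ∈ {0,…,n}, t ∈ ℕ and 2 ≤ j ≤ n. Assume H_p^l(j) = 0 for all l with 0 ≤ l ≤ t−1. Then: (i) H_p^l(j−1) = 0 for all l with 0 ≤ l ≤ t−1; (ii) the K-linear map H_p^t(j−1) → H_p^t(j) induced by the inclusion of complexes C_p^t(j−1) → C_p^t(j) (extend a family indexed by p-subsets of {1,…,j−1} by zero on p-subsets containing j) is injective; (iii) H_i^l(j) = 0 for all i with p ≤ i ≤ j and all l with 0 ≤ l ≤ t−1. -/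
open MvPolynomial

lemma koszulC_mono (n : ℕ) {K : Type*} [Field K] {M : Type*} [AddCommGroup M] [Module K M]
    (gr : ℤ → Submodule K M) (i : ℕ) (t : ℤ) {j j' : ℕ} (h : j' ≤ j) :
    koszulC n gr i t j' ≤ koszulC n gr i t j := by
  intro m hm J
  refine ⟨(hm J).1, fun hJ => (hm J).2 fun hc => hJ ⟨hc.1, fun k hk => lt_of_lt_of_le (hc.2 k hk) h⟩⟩

lemma koszulZ_mono (n : ℕ) {K : Type*} [Field K] {M : Type*} [AddCommGroup M] [Module K M]
    [Module (MvPolynomial (Fin n) K) M] [IsScalarTower K (MvPolynomial (Fin n) K) M]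
    (gr : ℤ → Submodule K M) (i : ℕ) (t : ℤ) {j j' : ℕ} (h : j' ≤ j) :
    koszulZ n gr i t j' ≤ koszulZ n gr i t j :=
  inf_le_inf_right _ (koszulC_mono n gr i t h)

lemma koszulB_mono (n : ℕ) {K : Type*} [Field K] {M : Type*} [AddCommGroup M] [Module K M]
    [Module (MvPolynomial (Fin n) K) M] [IsScalarTower K (MvPolynomial (Fin n) K) M]
    (gr : ℤ → Submodule K M) (i : ℕ) (t : ℤ) {j j' : ℕ} (h : j' ≤ j) :
    koszulB n gr i t j' ≤ koszulB n gr i t j :=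
  Submodule.map_mono (koszulC_mono n gr (i + 1) (t - 1) h)

lemma koszulB_comap_mono (n : ℕ) {K : Type*} [Field K] {M : Type*} [AddCommGroup M]
    [Module K M] [Module (MvPolynomial (Fin n) K) M]
    [IsScalarTower K (MvPolynomial (Fin n) K) M]
    (gr : ℤ → Submodule K M) (i : ℕ) (t : ℤ) {j j' : ℕ} (h : j' ≤ j) :
    (koszulB n gr i t j').comap (koszulZ n gr i t j').subtype ≤
      ((koszulB n gr i t j).comap (koszulZ n gr i t j).subtype).comap
        (Submodule.inclusion (koszulZ_mono n gr i t h)) := by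
  intro x hx
  simp only [Submodule.mem_comap, Submodule.subtype_apply, Submodule.coe_inclusion] at *
  exact koszulB_mono n gr i t h hx

section Koszul

variable {K : Type*} [Field K] {n : ℕ} {M : Type*} [AddCommGroup M] [Module K M]

/-- Extend a family `b` to the family whose value at `L` is `b (L \ {k})` if `k ∈ L` and `0`
otherwise; this is multiplication by the basis element `e_k`. -/
def koszulExt (k : Fin n) (b : Finset (Fin n) → M) : Finset (Fin n) → M :=
  fun L => if k ∈ L then b (L.erase k) else 0

lemma eq_zero_of_mem_koszulC {gr : ℤ → Submodule K M} {i : ℕ} {t : ℤ} {j : ℕ}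
    {b : Finset (Fin n) → M} (hb : b ∈ koszulC n gr i t j) {k : Fin n} (hk : j ≤ (k : ℕ))
    {L : Finset (Fin n)} (hL : k ∈ L) : b L = 0 :=
  (hb L).2 fun h => absurd (h.2 k hL) (by omega)

lemma eq_zero_of_add_koszulExt_eq_zero {k : Fin n} {u v : Finset (Fin n) → M}
    (hu : ∀ L, k ∈ L → u L = 0) (hv : ∀ L, k ∈ L → v L = 0)
    (h : u + koszulExt k v = 0) : u = 0 ∧ v = 0 := by
  constructor
  · funext L
    by_cases hL : k ∈ L
    · exact hu L hL
    · simpa [koszulExt, hL] using congrFun h L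
  · funext L
    by_cases hL : k ∈ L
    · exact hv L hL
    · simpa [koszulExt, hL, hu (insert k L) (Finset.mem_insert_self k L)]
        using congrFun h (insert k L)

lemma koszulExt_mem_koszulC {gr : ℤ → Submodule K M} {i : ℕ} {t : ℤ} {j : ℕ} {k : Fin n}
    (hk : (k : ℕ) = j) {b : Finset (Fin n) → M} (hb : b ∈ koszulC n gr i t j) :
    koszulExt k b ∈ koszulC n gr (i + 1) t (j + 1) := by
  intro L
  by_cases hL : k ∈ L
  · simp only [koszulExt, hL, if_true]
    refine ⟨(hb _).1, fun h => (hb _).2 fun h' => h ⟨?_, fun l hl => ?_⟩⟩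
    · rw [← Finset.card_erase_add_one hL, h'.1]
    · by_cases hlk : l = k
      · subst hlk; omega
      · exact (h'.2 l (Finset.mem_erase.2 ⟨hlk, hl⟩)).trans (Nat.lt_succ_self j)
  · simp [koszulExt, hL]

lemma exists_add_koszulExt {gr : ℤ → Submodule K M} {i : ℕ} {t : ℤ} {j : ℕ} {k : Fin n}
    (hk : (k : ℕ) = j) {m : Finset (Fin n) → M} (hm : m ∈ koszulC n gr (i + 1) t (j + 1)) :
    ∃ a ∈ koszulC n gr (i + 1) t j, ∃ b ∈ koszulC n gr i t j, m = a + koszulExt k b := by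
  refine ⟨fun L => if k ∈ L then 0 else m L, fun L => ?_,
    fun L => if k ∈ L then 0 else m (insert k L), fun L => ?_, ?_⟩
  · by_cases hL : k ∈ L
    · simp [hL]
    · simp only [hL, if_false]
      refine ⟨(hm L).1, fun h => (hm L).2 fun h' => h ⟨h'.1, fun l hl => ?_⟩⟩
      have h1 := h'.2 l hl
      have h2 : (l : ℕ) ≠ k := fun h => hL (Fin.ext h ▸ hl)
      omega
  · by_cases hL : k ∈ L
    · simp [hL]
    · simp only [hL, if_false]
      refine ⟨(hm _).1, fun h => (hm _).2 fun h' => h ⟨?_, fun l hl => ?_⟩⟩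
      · have := h'.1
        rw [Finset.card_insert_of_notMem hL] at this
        omega
      · have h1 := h'.2 l (Finset.mem_insert_of_mem hl)
        have h2 : (l : ℕ) ≠ k := fun h => hL (Fin.ext h ▸ hl)
        omega
  · funext L
    by_cases hL : k ∈ L <;> simp [koszulExt, hL]

lemma koszulC_eq_zero {gr : ℤ → Submodule K M} {i : ℕ} {t : ℤ} {j : ℕ} (ht : gr t = ⊥)
    {m : Finset (Fin n) → M} (hm : m ∈ koszulC n gr i t j) : m = 0 := by
  funext L
  simpa [ht] using (hm L).1

variable [Module (MvPolynomial (Fin n) K) M]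

lemma X_smul_mem_koszulC {gr : ℤ → Submodule K M}
    (hcompat : ∀ (i : Fin n) (l : ℤ), ∀ m ∈ gr l,
      (X i : MvPolynomial (Fin n) K) • m ∈ gr (l + 1))
    {i : ℕ} {t : ℤ} {j : ℕ} (k : Fin n) {b : Finset (Fin n) → M}
    (hb : b ∈ koszulC n gr i (t - 1) j) :
    (X k : MvPolynomial (Fin n) K) • b ∈ koszulC n gr i t j := by
  intro L
  refine ⟨by simpa using hcompat k _ _ (hb L).1, fun h => ?_⟩
  simp [(hb L).2 h]

variable [IsScalarTower K (MvPolynomial (Fin n) K) M]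

lemma koszulD_apply (m : Finset (Fin n) → M) (L : Finset (Fin n)) :
    koszulD (K := K) n m L = ∑ k ∈ Lᶜ, ((-1 : ℤ) ^ (L.filter (fun l => l < k)).card) •
      ((X k : MvPolynomial (Fin n) K) • m (insert k L)) := rfl

lemma koszulD_X_smul (k : Fin n) (m : Finset (Fin n) → M) :
    koszulD (K := K) n ((X k : MvPolynomial (Fin n) K) • m) =
      (X k : MvPolynomial (Fin n) K) • koszulD (K := K) n m := by
  funext L
  simp only [koszulD_apply, Pi.smul_apply, Finset.smul_sum]
  refine Finset.sum_congr rfl fun l _ => ?_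
  rw [smul_comm (X k : MvPolynomial (Fin n) K) ((-1 : ℤ) ^ _), smul_comm (X l) (X k)]

lemma koszulD_eq_zero_of_mem {gr : ℤ → Submodule K M} {i : ℕ} {t : ℤ} {j : ℕ}
    {b : Finset (Fin n) → M} (hb : b ∈ koszulC n gr i t j) {k : Fin n} (hk : j ≤ (k : ℕ))
    {L : Finset (Fin n)} (hL : k ∈ L) : koszulD (K := K) n b L = 0 := by
  rw [koszulD_apply]
  refine Finset.sum_eq_zero fun l _ => ?_
  rw [eq_zero_of_mem_koszulC hb hk (Finset.mem_insert_of_mem hL), smul_zero, smul_zero]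

lemma koszulD_koszulExt {gr : ℤ → Submodule K M} {i : ℕ} {t : ℤ} {j : ℕ} {k : Fin n}
    (hk : (k : ℕ) = j) {b : Finset (Fin n) → M} (hb : b ∈ koszulC n gr i t j) :
    koszulD (K := K) n (koszulExt k b) =
      koszulExt k (koszulD (K := K) n b) +
        (-1 : ℤ) ^ i • (X k : MvPolynomial (Fin n) K) • b := by
  funext L
  by_cases hL : k ∈ L
  · have hbL : b L = 0 := eq_zero_of_mem_koszulC hb hk.ge hL
    simp only [Pi.add_apply, Pi.smul_apply, hbL, smul_zero, add_zero, koszulExt, hL, if_true,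
      koszulD_apply, Finset.mem_insert, or_true]
    have hsub : Lᶜ ⊆ (L.erase k)ᶜ := Finset.compl_subset_compl.2 (Finset.erase_subset k L)
    rw [← Finset.sum_subset hsub]
    · refine Finset.sum_congr rfl fun l hl => ?_
      have hlL : l ∉ L := Finset.mem_compl.1 hl
      have hlk : k ≠ l := fun h => hlL (h ▸ hL)
      rw [Finset.erase_insert_of_ne hlk.symm]
      rcases lt_or_gt_of_ne hlk with h | h
      · rw [eq_zero_of_mem_koszulC hb (k := l) (by have : (k : ℕ) < l := h; omega)
          (Finset.mem_insert_self _ _)]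
        simp
      · congr 3
        ext x
        simp only [Finset.mem_filter, Finset.mem_erase]
        exact ⟨fun hx => ⟨⟨(hx.2.trans h).ne, hx.1⟩, hx.2⟩, fun hx => ⟨hx.1.2, hx.2⟩⟩
    · intro l hl hl'
      have hlk : l = k := by simp at hl hl'; tauto
      subst hlk
      rw [Finset.insert_erase hL, hbL]
      simp
  · simp only [Pi.add_apply, Pi.smul_apply, koszulExt, hL, if_false, zero_add, koszulD_apply]
    rw [Finset.sum_eq_single_of_mem k (Finset.mem_compl.2 hL)]
    · simp only [Finset.mem_insert_self, if_true, Finset.erase_insert hL]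
      by_cases hLc : L.card = i ∧ ∀ l ∈ L, (l : ℕ) < j
      · rw [Finset.filter_true_of_mem fun l hl => Fin.lt_def.2 (hk ▸ hLc.2 l hl), hLc.1]
      · simp [(hb L).2 hLc]
    · intro l _ hlk
      simp [Finset.mem_insert, hL, hlk.symm]

lemma mem_koszulB_of_mem_koszulB_succ {gr : ℤ → Submodule K M}
    (hcompat : ∀ (i : Fin n) (l : ℤ), ∀ m ∈ gr l,
      (X i : MvPolynomial (Fin n) K) • m ∈ gr (l + 1))
    {i : ℕ} {s : ℤ} {j : ℕ} (hj : j < n)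
    (hvan : koszulZ n gr i (s - 1) j ≤ koszulB n gr i (s - 1) j)
    {z : Finset (Fin n) → M} (hz : z ∈ koszulZ n gr i s j)
    (hzB : z ∈ koszulB n gr i s (j + 1)) : z ∈ koszulB n gr i s j := by
  obtain ⟨m, hm, rfl⟩ := hzB
  obtain ⟨a, ha, b, hb, rfl⟩ := exists_add_koszulExt (k := ⟨j, hj⟩) rfl hm
  set k : Fin n := ⟨j, hj⟩
  have hd := koszulD_koszulExt (k := k) rfl hb
  obtain ⟨h1, h2⟩ := eq_zero_of_add_koszulExt_eq_zero (k := k)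
    (u := koszulD (K := K) n a + (-1 : ℤ) ^ i • (X k : MvPolynomial (Fin n) K) • b
      - koszulD (K := K) n (a + koszulExt k b)) (v := koszulD (K := K) n b)
    (fun L hL => by
      simp only [Pi.sub_apply, Pi.add_apply, Pi.smul_apply]
      rw [koszulD_eq_zero_of_mem ha le_rfl hL, eq_zero_of_mem_koszulC hb le_rfl hL,
        eq_zero_of_mem_koszulC hz.1 le_rfl hL]
      simp)
    (fun L hL => koszulD_eq_zero_of_mem hb le_rfl hL)
    (by rw [map_add, hd]; abel)
  obtain ⟨c, hc, hcb⟩ := hvan ⟨hb, h2⟩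
  refine ⟨a + (-1 : ℤ) ^ i • (X k : MvPolynomial (Fin n) K) • c, ?_, ?_⟩
  · exact add_mem ha (zsmul_mem (X_smul_mem_koszulC hcompat k hc) _)
  · rw [← sub_eq_zero, ← h1, map_add, map_zsmul, koszulD_X_smul, hcb]

lemma koszulZ_le_koszulB_of_lt_zero {gr : ℤ → Submodule K M}
    (hneg : ∀ l : ℤ, l < 0 → gr l = ⊥) (i : ℕ) {s : ℤ} (hs : s < 0) (j : ℕ) :
    koszulZ n gr i s j ≤ koszulB n gr i s j := by
  intro z hz
  rw [koszulC_eq_zero (hneg s hs) hz.1]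
  exact zero_mem _

lemma koszulZ_le_koszulB_of_succ {gr : ℤ → Submodule K M}
    (hcompat : ∀ (i : Fin n) (l : ℤ), ∀ m ∈ gr l,
      (X i : MvPolynomial (Fin n) K) • m ∈ gr (l + 1))
    (hneg : ∀ l : ℤ, l < 0 → gr l = ⊥) {i t j : ℕ} (hj : j < n)
    (hvan : ∀ l : ℕ, l < t → koszulZ n gr i (l : ℤ) (j + 1) ≤ koszulB n gr i (l : ℤ) (j + 1))
    (l : ℕ) (hl : l < t) : koszulZ n gr i (l : ℤ) j ≤ koszulB n gr i (l : ℤ) j := by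
  induction l with
  | zero =>
    exact fun z hz => mem_koszulB_of_mem_koszulB_succ hcompat hj
      (koszulZ_le_koszulB_of_lt_zero hneg i (by simp) j) hz
      (hvan 0 hl (koszulZ_mono n gr i _ j.le_succ hz))
  | succ l ih =>
    exact fun z hz => mem_koszulB_of_mem_koszulB_succ hcompat hj
      (by simpa using ih (by omega)) hz
      (hvan (l + 1) hl (koszulZ_mono n gr i _ j.le_succ hz))

lemma koszulZ_succ_le_koszulB_succ {gr : ℤ → Submodule K M}
    (hcompat : ∀ (i : Fin n) (l : ℤ), ∀ m ∈ gr l,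
      (X i : MvPolynomial (Fin n) K) • m ∈ gr (l + 1))
    {i : ℕ} {s : ℤ} {j : ℕ} (hj : j < n)
    (hvan : koszulZ n gr i s j ≤ koszulB n gr i s j)
    (hvan' : koszulZ n gr (i + 1) s j ≤ koszulB n gr (i + 1) s j) :
    koszulZ n gr (i + 1) s (j + 1) ≤ koszulB n gr (i + 1) s (j + 1) := by
  rintro z ⟨hz, hdz⟩
  obtain ⟨a, ha, b, hb, rfl⟩ := exists_add_koszulExt (k := ⟨j, hj⟩) rfl hz
  set k : Fin n := ⟨j, hj⟩
  have hd := koszulD_koszulExt (k := k) rfl hb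
  have hdz' : koszulD (K := K) n (a + koszulExt k b) = 0 := hdz
  obtain ⟨h1, h2⟩ := eq_zero_of_add_koszulExt_eq_zero (k := k)
    (u := koszulD (K := K) n a + (-1 : ℤ) ^ i • (X k : MvPolynomial (Fin n) K) • b)
    (v := koszulD (K := K) n b)
    (fun L hL => by
      simp only [Pi.add_apply, Pi.smul_apply]
      rw [koszulD_eq_zero_of_mem ha le_rfl hL, eq_zero_of_mem_koszulC hb le_rfl hL]
      simp)
    (fun L hL => koszulD_eq_zero_of_mem hb le_rfl hL)
    (by rw [← hdz', map_add, hd]; abel)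
  obtain ⟨c, hc, hcb⟩ := hvan ⟨hb, h2⟩
  have hdc := koszulD_koszulExt (k := k) rfl hc
  have ha' : a - (-1 : ℤ) ^ (i + 1) • (X k : MvPolynomial (Fin n) K) • c ∈
      koszulZ n gr (i + 1) s j := by
    refine ⟨sub_mem ha (zsmul_mem (X_smul_mem_koszulC hcompat k hc) _), ?_⟩
    rw [SetLike.mem_coe, LinearMap.mem_ker, map_sub, map_zsmul, koszulD_X_smul, hcb, ← h1,
      pow_succ]
    simp
  have key : a + koszulExt k b =
      (a - (-1 : ℤ) ^ (i + 1) • (X k : MvPolynomial (Fin n) K) • c) +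
        koszulD (K := K) n (koszulExt k c) := by
    rw [hdc, hcb]; abel
  rw [key]
  exact add_mem (koszulB_mono n gr _ _ j.le_succ (hvan' ha'))
    ⟨_, koszulExt_mem_koszulC rfl hc, rfl⟩

lemma koszulZ_le_koszulB_homological_succ {gr : ℤ → Submodule K M}
    (hcompat : ∀ (i : Fin n) (l : ℤ), ∀ m ∈ gr l,
      (X i : MvPolynomial (Fin n) K) • m ∈ gr (l + 1))
    (hneg : ∀ l : ℤ, l < 0 → gr l = ⊥) {i t j : ℕ} (hj : j ≤ n)
    (hvan : ∀ l : ℕ, l < t → koszulZ n gr i (l : ℤ) j ≤ koszulB n gr i (l : ℤ) j)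
    (l : ℕ) (hl : l < t) :
    koszulZ n gr (i + 1) (l : ℤ) j ≤ koszulB n gr (i + 1) (l : ℤ) j := by
  induction j with
  | zero =>
    intro z hz
    have : z = 0 := by
      funext L
      refine (hz.1 L).2 fun h => ?_
      obtain ⟨k, hk⟩ := Finset.card_pos.1 (by omega : 0 < L.card)
      exact absurd (h.2 k hk) (Nat.not_lt_zero _)
    rw [this]
    exact zero_mem _
  | succ j ih =>
    have hvan' := koszulZ_le_koszulB_of_succ hcompat hneg hj hvan
    exact koszulZ_succ_le_koszulB_succ hcompat hj (hvan' l hl) (ih (by omega) hvan')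

end Koszul

open MvPolynomial in
/-- Lemma 1.3: if `H_p^l(j) = 0` for `0 ≤ l ≤ t-1`, then
(i) `H_p^l(j-1) = 0` for `0 ≤ l ≤ t-1`; (ii) the map `H_p^t(j-1) → H_p^t(j)`
induced by the inclusion of complexes is injective; (iii) `H_i^l(j) = 0` for
`p ≤ i ≤ j` and `0 ≤ l ≤ t-1`. -/
theorem koszul_homology_vanishing_transfer {K : Type*} [Field K] {n : ℕ}
    {M : Type*} [AddCommGroup M] [Module K M]
    [Module (MvPolynomial (Fin n) K) M] [IsScalarTower K (MvPolynomial (Fin n) K) M]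
    (gr : ℤ → Submodule K M)
    (hdecomp : DirectSum.IsInternal gr)
    (hcompat : ∀ (i : Fin n) (l : ℤ), ∀ m ∈ gr l,
      (X i : MvPolynomial (Fin n) K) • m ∈ gr (l + 1))
    (hneg : ∀ l : ℤ, l < 0 → gr l = ⊥)
    (p : ℕ) (t : ℕ) (j : ℕ) (hj2 : 2 ≤ j) (hjn : j ≤ n) (hpn : p ≤ n)
    (hvanish : ∀ l : ℕ, l < t →
      koszulZ n gr p (l : ℤ) j ≤ koszulB n gr p (l : ℤ) j) :
    (∀ l : ℕ, l < t →
        koszulZ n gr p (l : ℤ) (j - 1) ≤ koszulB n gr p (l : ℤ) (j - 1)) ∧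
    Function.Injective
      (Submodule.mapQ
        ((koszulB n gr p (t : ℤ) (j - 1)).comap (koszulZ n gr p (t : ℤ) (j - 1)).subtype)
        ((koszulB n gr p (t : ℤ) j).comap (koszulZ n gr p (t : ℤ) j).subtype)
        (Submodule.inclusion (koszulZ_mono n gr p (t : ℤ) (Nat.sub_le j 1)))
        (koszulB_comap_mono n gr p (t : ℤ) (Nat.sub_le j 1))) ∧
    (∀ i : ℕ, p ≤ i → i ≤ j → ∀ l : ℕ, l < t →
        koszulZ n gr i (l : ℤ) j ≤ koszulB n gr i (l : ℤ) j) := by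
  obtain ⟨j, rfl⟩ : ∃ k, j = k + 1 := ⟨j - 1, by omega⟩
  have hprev := koszulZ_le_koszulB_of_succ hcompat hneg hjn hvanish
  refine ⟨hprev, ?_, ?_⟩
  · have hprev' : koszulZ n gr p ((t : ℤ) - 1) j ≤ koszulB n gr p ((t : ℤ) - 1) j := by
      cases t with
      | zero => exact koszulZ_le_koszulB_of_lt_zero hneg p (by simp) j
      | succ t => simpa using hprev t (Nat.lt_succ_self t)
    rw [injective_iff_map_eq_zero]
    intro q
    obtain ⟨z, rfl⟩ := Submodule.Quotient.mk_surjective _ q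
    intro h
    rw [Submodule.mapQ_apply, Submodule.Quotient.mk_eq_zero] at h
    rw [Submodule.Quotient.mk_eq_zero]
    exact mem_koszulB_of_mem_koszulB_succ hcompat hjn hprev' z.2 h
  · intro i hpi _
    induction i, hpi using Nat.le_induction with
    | base => exact hvanish
    | succ i _ ih =>
      exact koszulZ_le_koszulB_homological_succ hcompat hneg hjn (ih (by omega))
end

section
/- Order the p-element subsets of {1,…,j} by: A ≻ B iff, writing A = {a_1<…<a_p} and B = {b_1<…<b_p}, there is an index s with a_l = b_l for l < s and a_s < b_s. Let p ∈ {0,…,j}, t ∈ ℕ, let z = (m_J) ∈ C_p^t(j) be nonzero, and let J* be the ≻-largest p-element subset of {1,…,j} with m_{J*} ≠ 0. For r ∈ {0,…,p} and I ⊆ J* with |I| = r, define ∂_I(z) ∈ C_{p−r}^t(j) by (∂_I z)_L = (−1)^{α(I,L)+r(r−1)/2}·m_{I∪L} if I∩L = ∅ and (∂_I z)_L = 0 otherwise, where α(I,L) = |{(a,b) ∈ I×L : a > b}| (this is the iterated contraction ∂_{i_1}∘⋯∘∂_{i_r} applied to z for I = {i_1<…<i_r}). Then the family {∂_I(z) :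 I ⊆ J*, |I| = r} is K-linearly independent in C_{p−r}^t(j). Moreover, if d(z) = 0 then d(∂_I(z)) = 0 for every such I. -/
open MvPolynomial

/-- The order on `p`-element subsets: `A ≻ B` iff, writing the elements in increasing
order, at the first index where they differ `A` has the smaller element. -/
def finsetSucc {n : ℕ} (A B : Finset (Fin n)) : Prop :=
  List.Lex (· < ·) (A.sort (· ≤ ·)) (B.sort (· ≤ ·))

/-- The iterated contraction `∂_I = ∂_{i_1} ∘ ⋯ ∘ ∂_{i_r}` for `I = {i_1 < … < i_r}`:
`(∂_I z)_L = (−1)^{α(I,L) + r(r−1)/2} · z_{I ∪ L}` if `I ∩ L = ∅`, and `0` otherwise,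
where `α(I,L) = |{(a,b) ∈ I × L : a > b}|`. -/
def koszulContrSet {n : ℕ} {M : Type*} [AddCommGroup M] (I : Finset (Fin n))
    (z : Finset (Fin n) → M) : Finset (Fin n) → M :=
  fun L => if Disjoint I L then
      ((-1 : ℤ) ^ (((I ×ˢ L).filter fun q => q.2 < q.1).card + I.card * (I.card - 1) / 2)) •
        z (I ∪ L)
    else 0

theorem koszulContrSet_of_disjoint {n : ℕ} {M : Type*} [AddCommGroup M] {I L : Finset (Fin n)}
    (h : Disjoint I L) (z : Finset (Fin n) → M) :
    koszulContrSet I z L =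
      ((-1 : ℤ) ^ (((I ×ˢ L).filter fun q => q.2 < q.1).card + I.card * (I.card - 1) / 2)) •
        z (I ∪ L) :=
  if_pos h

theorem koszulContrSet_of_not_disjoint {n : ℕ} {M : Type*} [AddCommGroup M]
    {I L : Finset (Fin n)} (h : ¬Disjoint I L) (z : Finset (Fin n) → M) :
    koszulContrSet I z L = 0 :=
  if_neg h

/-- Contractions of `z` along the `r`-element subsets of any set `J` with `z J ≠ 0` are
linearly independent: evaluation at `J \ I` detects only the contraction along `I`. -/
theorem linearIndependent_koszulContrSet {K : Type*} [Field K] {n : ℕ} {M : Type*}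
    [AddCommGroup M] [Module K M] (z : Finset (Fin n) → M) {J : Finset (Fin n)}
    (hJ : z J ≠ 0) (r : ℕ) :
    LinearIndependent K
      (fun I : {I : Finset (Fin n) // I ⊆ J ∧ I.card = r} => koszulContrSet I.1 z) := by
  rw [Fintype.linearIndependent_iff]
  intro c hc I
  have h := congrFun hc (J \ I.1)
  rw [Finset.sum_apply, Finset.sum_eq_single I, Pi.smul_apply,
    koszulContrSet_of_disjoint Finset.disjoint_sdiff, Finset.union_sdiff_of_subset I.2.1] at h
  · rcases smul_eq_zero.mp h with h | h
    · exact h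
    · rcases neg_one_pow_eq_or ℤ (((I.1 ×ˢ (J \ I.1)).filter fun q => q.2 < q.1).card +
        I.1.card * (I.1.card - 1) / 2) with e | e <;> rw [e] at h <;> simp [hJ] at h
  · intro I' _ hne
    rw [Pi.smul_apply, koszulContrSet_of_not_disjoint, smul_zero]
    intro hdis
    refine hne (Subtype.ext (Finset.eq_of_subset_of_card_le (fun a ha => ?_) ?_))
    · by_contra haI
      exact Finset.disjoint_left.mp hdis ha (Finset.mem_sdiff.mpr ⟨I'.2.1 ha, haI⟩)
    · rw [I.2.2, I'.2.2]
  · simp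

theorem card_filter_inversions_insert {α : Type*} [LinearOrder α] {I L : Finset α} {k : α}
    (hI : k ∉ I) (hL : k ∉ L) :
    ((I ×ˢ insert k L).filter fun q => q.2 < q.1).card + (I.filter (· < k)).card =
      ((I ×ˢ L).filter fun q => q.2 < q.1).card + I.card := by
  have hgt : ((I ×ˢ insert k L).filter fun q => q.2 < q.1).card =
      ((I ×ˢ L).filter fun q => q.2 < q.1).card + (I.filter (k < ·)).card := by
    simp only [Finset.card_filter, Finset.sum_product, Finset.sum_insert hL,
      Finset.sum_add_distrib]
    exact add_comm _ _
  have hcompl : I.filter (k < ·) = I.filter fun a => ¬a < k :=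
    Finset.filter_congr fun a ha => by
      rw [not_lt]
      exact ⟨le_of_lt, fun h => lt_of_le_of_ne h fun e => hI (e ▸ ha)⟩
  rw [hgt, hcompl, add_assoc, add_comm (Finset.card _) (I.filter (· < k)).card,
    Finset.card_filter_add_card_filter_not]

/-- The contraction along `I` commutes with the Koszul differential up to `(-1) ^ |I|`. -/
theorem koszulD_koszulContrSet {K : Type*} [Field K] {n : ℕ} {M : Type*} [AddCommGroup M]
    [Module K M] [Module (MvPolynomial (Fin n) K) M]
    [IsScalarTower K (MvPolynomial (Fin n) K) M] (I : Finset (Fin n))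
    (z : Finset (Fin n) → M) :
    koszulD n (K := K) (koszulContrSet I z) =
      ((-1 : ℤ) ^ I.card) • koszulContrSet I (koszulD n (K := K) z) := by
  funext L
  rw [Pi.smul_apply]
  by_cases hdis : Disjoint I L
  · rw [koszulContrSet_of_disjoint hdis]
    simp only [koszulD, LinearMap.coe_mk, AddHom.coe_mk, Finset.smul_sum]
    symm
    refine Finset.sum_subset_zero_on_sdiff
      (Finset.compl_subset_compl.mpr Finset.subset_union_right) (fun k hk => ?_) fun k hk => ?_
    · rw [koszulContrSet_of_not_disjoint, smul_zero, smul_zero]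
      simp only [Finset.mem_sdiff, Finset.mem_compl, Finset.mem_union] at hk
      have hkI : k ∈ I := by tauto
      exact fun h => Finset.disjoint_left.mp h hkI (Finset.mem_insert_self k L)
    · simp only [Finset.mem_compl, Finset.mem_union, not_or] at hk
      obtain ⟨hkI, hkL⟩ := hk
      rw [koszulContrSet_of_disjoint (Finset.disjoint_insert_right.mpr ⟨hkI, hdis⟩),
        Finset.union_insert, smul_comm (X k : MvPolynomial (Fin n) K), smul_smul, smul_smul,
        smul_smul, ← pow_add, ← pow_add, ← pow_add, Finset.filter_union,
        Finset.card_union_of_disjoint (Finset.disjoint_filter_filter hdis)]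
      congr 1
      have h := card_filter_inversions_insert hkI hkL
      rw [neg_one_pow_congr]
      rw [Nat.even_iff, Nat.even_iff]
      omega
  · rw [koszulContrSet_of_not_disjoint hdis, smul_zero]
    refine Finset.sum_eq_zero fun k _ => ?_
    rw [koszulContrSet_of_not_disjoint, smul_zero, smul_zero]
    exact fun h => hdis (h.mono_right (Finset.subset_insert k L))

open MvPolynomial in
/-- Lemma 2.1: if `z ∈ C_p^t(j)` is nonzero with `≻`-largest support
set `J*`, then for every `r ≤ p` the contractions `∂_I(z)`, `I ⊆ J*`, `|I| = r`, are
`K`-linearly independent; moreover if `z` is a cycle then so is every `∂_I(z)`. -/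
theorem contractions_linearly_independent {K : Type*} [Field K] {n : ℕ}
    {M : Type*} [AddCommGroup M] [Module K M]
    [Module (MvPolynomial (Fin n) K) M] [IsScalarTower K (MvPolynomial (Fin n) K) M]
    (gr : ℤ → Submodule K M)
    (hdecomp : DirectSum.IsInternal gr)
    (hcompat : ∀ (i : Fin n) (l : ℤ), ∀ m ∈ gr l,
      (X i : MvPolynomial (Fin n) K) • m ∈ gr (l + 1))
    (hneg : ∀ l : ℤ, l < 0 → gr l = ⊥)
    (p : ℕ) (t : ℕ) (j : ℕ) (hpj : p ≤ j) (hj1 : 1 ≤ j) (hjn : j ≤ n)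
    (z : Finset (Fin n) → M) (hz : z ∈ koszulC n gr p (t : ℤ) j) (hz0 : z ≠ 0)
    (Jstar : Finset (Fin n)) (hJcard : Jstar.card = p) (hJne : z Jstar ≠ 0)
    (hJmax : ∀ J : Finset (Fin n), z J ≠ 0 → J ≠ Jstar → finsetSucc Jstar J) :
    (∀ r : ℕ, r ≤ p →
      LinearIndependent K
        (fun I : {I : Finset (Fin n) // I ⊆ Jstar ∧ I.card = r} =>
          koszulContrSet I.1 z)) ∧
    (koszulD n (K := K) z = 0 → ∀ I : Finset (Fin n), I ⊆ Jstar → koszulD n (K := K) (koszulContrSet I z) = 0) := by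
  refine ⟨fun r _ => linearIndependent_koszulContrSet z hJne r, fun hd I _ => ?_⟩
  rw [koszulD_koszulContrSet, hd]
  funext L
  simp [koszulContrSet]
end
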